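/- arXiv:1805.01624 — 3 statements merged into one kernel-verified Lean document; each statement's English description precedes it below -/
import Mathlib

section
/- Let Ξ = [v_1 ⋯ v_n] be a matrix of direction vectors v_k ∈ ℤ^d ∖ {0} with n ≥ d and Ξ_d := [v_1 ⋯ v_d] nonsingular, and let M_Ξ be the associated box spline. Then for every continuous compactly supported function f : ℝ^d → ℝ one has ∫_{ℝ^d} M_Ξ(x) f(x) dx = ∫_{[0,1]^n} f(Ξ t) dt. -/
open MeasureTheory

open Classical in
/-- The box spline on `d` columns: value `1/|det A|` on `A [0,1)^d`, zero elsewhere. -/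
noncomputable def boxSplineBase (d : ℕ) (A : Matrix (Fin d) (Fin d) ℝ)
    (x : Fin d → ℝ) : ℝ :=
  if ∃ u : Fin d → ℝ, (∀ i, 0 ≤ u i ∧ u i < 1) ∧ A.mulVec u = x then |A.det|⁻¹ else 0

/-- The box spline `M_Ξ` associated with direction vectors `v 0, …, v (n-1)` (columns of `Ξ`),
defined by the recursive convolution formula. Junk value `0` when `n < d`. -/
noncomputable def boxSpline (d : ℕ) : (n : ℕ) → (Fin n → Fin d → ℝ) → (Fin d → ℝ) → ℝ
  | n, v, x =>
    if h : n = d then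
      boxSplineBase d (Matrix.of fun i j => v (Fin.cast h.symm j) i) x
    else if hle : n ≤ d then 0
    else
      ∫ t in (0:ℝ)..1,
        boxSpline d (n - 1) (fun k => v (Fin.castLE (Nat.sub_le n 1) k))
          (fun i => x i - t * v ⟨n - 1, Nat.sub_lt (by omega) one_pos⟩ i)
  termination_by n => n
  decreasing_by omega

/-- The real matrix of columns obtained from integer direction vectors. -/
def intCols (d n : ℕ) (v : Fin n → Fin d → ℤ) : Fin n → Fin d → ℝ :=
  fun k i => (v k i : ℝ)

/-- The square matrix `Ξ_d` formed by the first `d` columns. -/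
def leadMat (d n : ℕ) (hdn : d ≤ n) (w : Fin n → Fin d → ℝ) :
    Matrix (Fin d) (Fin d) ℝ :=
  Matrix.of fun i j => w (Fin.castLE hdn j) i

/-- The linear map `t ↦ Ξ t = ∑ k, t k • v k`. -/
def xiVec (d n : ℕ) (w : Fin n → Fin d → ℝ) (t : Fin n → ℝ) : Fin d → ℝ :=
  fun i => ∑ k, t k * w k i

theorem mulVec_injective_of_det_ne_zero {d : ℕ} {A : Matrix (Fin d) (Fin d) ℝ} (hA : A.det ≠ 0) :
    Function.Injective A.mulVec :=
  Matrix.mulVec_injective_iff_isUnit.2 ((Matrix.isUnit_iff_isUnit_det A).2 hA.isUnit)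

theorem measurableEmbedding_toLin' {d : ℕ} {A : Matrix (Fin d) (Fin d) ℝ} (hA : A.det ≠ 0) :
    MeasurableEmbedding (Matrix.toLin' A) :=
  (LinearMap.continuous_on_pi _).measurableEmbedding (mulVec_injective_of_det_ne_zero hA)

/-- The indicator function defining the base box spline pulls back to the half-open unit cube. -/
theorem boxSplineBase_mulVec (d : ℕ) (A : Matrix (Fin d) (Fin d) ℝ) (hA : A.det ≠ 0) :
    (fun u => boxSplineBase d A (A.mulVec u)) =
      (Set.pi Set.univ fun _ => Set.Ico (0 : ℝ) 1).indicator fun _ => |A.det|⁻¹ := by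
  have hinj := mulVec_injective_of_det_ne_zero hA
  funext u
  by_cases hu : u ∈ Set.pi Set.univ fun _ : Fin d => Set.Ico (0 : ℝ) 1
  · rw [Set.indicator_of_mem hu, boxSplineBase, if_pos]
    exact ⟨u, fun i => hu i (Set.mem_univ i), rfl⟩
  · rw [Set.indicator_of_notMem hu, boxSplineBase, if_neg]
    rintro ⟨u', hu', h⟩
    obtain rfl := hinj h
    exact hu fun i _ => hu' i

/-- The base box spline is integrable. -/
theorem integrable_boxSplineBase (d : ℕ) (A : Matrix (Fin d) (Fin d) ℝ) (hA : A.det ≠ 0) :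
    Integrable (boxSplineBase d A) := by
  have hemb := measurableEmbedding_toLin' hA
  have hcube : Integrable (fun u => boxSplineBase d A (A.mulVec u)) := by
    rw [boxSplineBase_mulVec d A hA, integrable_indicator_iff
      (MeasurableSet.univ_pi fun _ => measurableSet_Ico)]
    refine integrableOn_const ?_
    simp [volume_pi, Measure.pi_pi]
  have hmap : Integrable (boxSplineBase d A) (Measure.map (Matrix.toLin' A) volume) :=
    hemb.integrable_map_iff.2 hcube
  rw [Real.map_matrix_volume_pi_eq_smul_volume_pi hA] at hmap
  refine (integrable_smul_measure ?_ ENNReal.ofReal_ne_top).1 hmap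
  simpa using hA

/-- Integration against the base box spline. -/
theorem integral_boxSplineBase_mul (d : ℕ) (A : Matrix (Fin d) (Fin d) ℝ) (hA : A.det ≠ 0)
    (f : (Fin d → ℝ) → ℝ) :
    ∫ x, boxSplineBase d A x * f x = ∫ u in Set.Icc (0 : Fin d → ℝ) 1, f (A.mulVec u) := by
  have hemb := measurableEmbedding_toLin' hA
  have hmap := hemb.integral_map (μ := volume) fun x => boxSplineBase d A x * f x
  rw [Real.map_matrix_volume_pi_eq_smul_volume_pi hA, integral_smul_measure,
    ENNReal.toReal_ofReal (abs_nonneg _), abs_inv] at hmap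
  have hpull : ∀ u, boxSplineBase d A (Matrix.toLin' A u) * f (Matrix.toLin' A u) =
      |A.det|⁻¹ * (Set.pi Set.univ fun _ => Set.Ico (0 : ℝ) 1).indicator
        (fun u => f (A.mulVec u)) u := by
    intro u
    have h := congrFun (boxSplineBase_mulVec d A hA) u
    rw [Matrix.toLin'_apply, h]
    by_cases hu : u ∈ Set.pi Set.univ fun _ : Fin d => Set.Ico (0 : ℝ) 1 <;> simp only [hu,
      Set.indicator_of_mem, Set.indicator_of_notMem, not_false_eq_true, zero_mul, mul_zero]
  simp only [hpull] at hmap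
  rw [integral_const_mul, smul_eq_mul,
    integral_indicator (MeasurableSet.univ_pi fun _ => measurableSet_Ico)] at hmap
  rw [mul_left_cancel₀ (inv_ne_zero (abs_ne_zero.2 hA)) hmap]
  exact setIntegral_congr_set (Measure.univ_pi_Ico_ae_eq_Icc (f := 0) (g := 1))

/-- The box spline on exactly `d` directions. -/
theorem boxSpline_self (d : ℕ) (w : Fin d → Fin d → ℝ) :
    boxSpline d d w = boxSplineBase d (leadMat d d le_rfl w) := by
  funext x
  rw [boxSpline, dif_pos rfl]
  rfl

/-- The convolution recursion of the box spline. -/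
theorem boxSpline_succ (d n : ℕ) (hdn : d ≤ n) (w : Fin (n + 1) → Fin d → ℝ) :
    boxSpline d (n + 1) w = fun x => ∫ t in Set.Icc (0 : ℝ) 1,
      boxSpline d n (fun k => w k.castSucc) (x - t • w (Fin.last n)) := by
  funext x
  rw [boxSpline, dif_neg (by omega), dif_neg (by omega),
    intervalIntegral.integral_of_le zero_le_one, ← integral_Icc_eq_integral_Ioc]
  rfl

/-- The linear map `Ξ` splits off its last column. -/
theorem xiVec_snoc (d n : ℕ) (w : Fin (n + 1) → Fin d → ℝ) (s : Fin n → ℝ) (t : ℝ) :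
    xiVec d (n + 1) w (Fin.snoc s t) =
      xiVec d n (fun k => w k.castSucc) s + t • w (Fin.last n) := by
  funext i
  simp [xiVec, Fin.sum_univ_castSucc]

theorem continuous_xiVec (d n : ℕ) (w : Fin n → Fin d → ℝ) : Continuous (xiVec d n w) := by
  unfold xiVec
  fun_prop

/-- Integration over a unit cube, with the last coordinate integrated last. -/
theorem integral_Icc_fin_succ (n : ℕ) (g : (Fin (n + 1) → ℝ) → ℝ) (hg : Continuous g) :
    ∫ t in Set.Icc (0 : Fin (n + 1) → ℝ) 1, g t =
      ∫ t in Set.Icc (0 : ℝ) 1, ∫ s in Set.Icc (0 : Fin n → ℝ) 1, g (Fin.snoc s t) := by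
  let e := (MeasurableEquiv.piFinSuccAbove (fun _ : Fin (n + 1) => ℝ) (Fin.last n)).symm
  have he : MeasurePreserving e := (volume_preserving_piFinSuccAbove _ _).symm
  have happ : ∀ p, e p = Fin.snoc p.2 p.1 := fun p => Fin.insertNth_last' _ _
  have hpre : e ⁻¹' Set.Icc 0 1 = Set.Icc (0 : ℝ) 1 ×ˢ Set.Icc (0 : Fin n → ℝ) 1 := by
    ext p
    simp only [Set.mem_preimage, happ, Set.mem_Icc, Set.mem_prod, Pi.le_def, Fin.forall_fin_succ',
      Fin.snoc_castSucc, Fin.snoc_last, Pi.zero_apply, Pi.one_apply]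
    tauto
  have hcont : Continuous fun p : ℝ × (Fin n → ℝ) => g (Fin.snoc p.2 p.1) :=
    hg.comp (Continuous.finSnoc (A := fun _ => ℝ) continuous_snd continuous_fst)
  rw [← he.setIntegral_preimage_emb e.measurableEmbedding, hpre]
  simp only [happ]
  exact setIntegral_prod _ (hcont.continuousOn.integrableOn_compact
    (isCompact_Icc.prod isCompact_Icc))

/-- Shearing an integrable function along a direction, over the unit parameter interval. -/
theorem integrable_shear {d : ℕ} {B : (Fin d → ℝ) → ℝ} (hB : Integrable B) (a : Fin d → ℝ) :
    Integrable (fun p : ℝ × (Fin d → ℝ) => B (p.2 - p.1 • a))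
      ((volume.restrict (Set.Icc (0 : ℝ) 1)).prod volume) := by
  have hmp : MeasurePreserving (fun p : ℝ × (Fin d → ℝ) => (p.1, p.2 - p.1 • a))
      ((volume.restrict (Set.Icc (0 : ℝ) 1)).prod volume)
      ((volume.restrict (Set.Icc (0 : ℝ) 1)).prod volume) :=
    (MeasurePreserving.id _).skew_product (g := fun t x => x - t • a) (by fun_prop)
      (Filter.Eventually.of_forall fun t => (measurePreserving_sub_right volume (t • a)).map_eq)
  exact hmp.integrable_comp_of_integrable (hB.comp_snd _)

/-- Box splines with nonsingular leading block are integrable, and integrating a bounded continuous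
function against one amounts to integrating its pullback over the unit cube. -/
theorem integrable_boxSpline_and_integral_mul (d n : ℕ) (hdn : d ≤ n) (w : Fin n → Fin d → ℝ)
    (hns : (leadMat d n hdn w).det ≠ 0) :
    Integrable (boxSpline d n w) ∧
      ∀ f : (Fin d → ℝ) → ℝ, Continuous f → (∃ C, ∀ x, ‖f x‖ ≤ C) →
        ∫ x, boxSpline d n w x * f x =
          ∫ t in Set.Icc (0 : Fin n → ℝ) 1, f (xiVec d n w t) := by
  induction n, hdn using Nat.le_induction with
  | base =>
    rw [boxSpline_self]
    refine ⟨integrable_boxSplineBase d _ hns, fun f _ _ => ?_⟩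
    rw [integral_boxSplineBase_mul d _ hns]
    congr! 3 with u
    funext i
    simp [Matrix.mulVec, dotProduct, leadMat, xiVec, mul_comm]
  | succ n hdn ih =>
    obtain ⟨hB, hint⟩ := ih (fun k => w k.castSucc) hns
    rw [boxSpline_succ d n hdn]
    set B := boxSpline d n fun k => w k.castSucc
    set a := w (Fin.last n)
    have hshear := integrable_shear hB a
    refine ⟨hshear.integral_prod_right, fun f hf ⟨C, hC⟩ => ?_⟩
    have hprod : Integrable (fun p : ℝ × (Fin d → ℝ) => B (p.2 - p.1 • a) * f p.2)
        ((volume.restrict (Set.Icc (0 : ℝ) 1)).prod volume) :=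
      hshear.mul_bdd (c := C) (by fun_prop) (Filter.Eventually.of_forall fun p => hC p.2)
    calc ∫ x, (∫ t in Set.Icc (0 : ℝ) 1, B (x - t • a)) * f x
        = ∫ x, ∫ t in Set.Icc (0 : ℝ) 1, B (x - t • a) * f x := by
          simp only [integral_mul_const]
      _ = ∫ t in Set.Icc (0 : ℝ) 1, ∫ x, B (x - t • a) * f x :=
          (integral_integral_swap hprod).symm
      _ = ∫ t in Set.Icc (0 : ℝ) 1, ∫ x, B x * f (x + t • a) := by
          congr! 2 with t
          rw [← integral_sub_right_eq_self (fun x => B x * f (x + t • a)) (t • a)]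
          simp only [sub_add_cancel]
      _ = ∫ t in Set.Icc (0 : ℝ) 1, ∫ s in Set.Icc (0 : Fin n → ℝ) 1,
            f (xiVec d (n + 1) w (Fin.snoc s t)) := by
          congr! 2 with t
          rw [hint (fun x => f (x + t • a)) (by fun_prop) ⟨C, fun x => hC _⟩]
          simp only [xiVec_snoc, a]
      _ = _ := (integral_Icc_fin_succ n _ (hf.comp (continuous_xiVec d (n + 1) w))).symm

/-- For every continuous compactly supported `f : ℝ^d → ℝ`,
`∫_{ℝ^d} M_Ξ(x) f(x) dx = ∫_{[0,1]^n} f(Ξ t) dt`. -/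
theorem boxSpline_integral_eq (d n : ℕ) (hdn : d ≤ n)
    (v : Fin n → Fin d → ℤ) (hv : ∀ k, v k ≠ 0)
    (hns : (leadMat d n hdn (intCols d n v)).det ≠ 0)
    (f : (Fin d → ℝ) → ℝ) (hf : Continuous f) (hfc : HasCompactSupport f) :
    ∫ x, boxSpline d n (intCols d n v) x * f x
      = ∫ t in Set.Icc (0 : Fin n → ℝ) 1, f (xiVec d n (intCols d n v) t) :=
  (integrable_boxSpline_and_integral_mul d n hdn _ hns).2 f hf (hfc.exists_bound_of_continuous hf)
end

section
/- Let Ξ = [v_1 ⋯ v_n] be a matrix of direction vectors v_k ∈ ℤ^d ∖ {0} with n ≥ d and Ξ_d := [v_1 ⋯ v_d] nonsingular, and let ρ(Ξ) denote the minimal number of columns that need to be removed from Ξ to obtain a matrix whose columns do not span ℝ^d. If ρ(Ξ) ≥ 2, then the box spline M_Ξ is ρ(Ξ) − 2 times continuously differentiable on ℝ^d. -/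
open MeasureTheory

/-- `ρ(Ξ)`: the minimal number of columns that need to be removed from `Ξ` so that the
remaining columns do not span `ℝ^d`. -/
noncomputable def rhoXi (d n : ℕ) (w : Fin n → Fin d → ℝ) : ℕ :=
  sInf {m : ℕ | ∃ S : Finset (Fin n), S.card = m ∧
    Submodule.span ℝ (w '' ↑(Sᶜ)) ≠ (⊤ : Submodule ℝ (Fin d → ℝ))}

open Filter Topology MeasureTheory ProbabilityTheory

section Auxiliary

theorem hasFDerivAt_of_continuous_directional {E : Type*} [NormedAddCommGroup E]
    [NormedSpace ℝ E] [FiniteDimensional ℝ E] {ι : Type*} [Fintype ι]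
    (b : Module.Basis ι ℝ E) {f : E → ℝ} {D : ι → E → ℝ} (hD : ∀ i, Continuous (D i))
    (hf : ∀ i x, HasDerivAt (fun s : ℝ => f (x + s • b i)) (D i x) 0) (x : E) :
    HasFDerivAt f (∑ i, D i x • LinearMap.toContinuousLinearMap (b.coord i)) x := by
  classical
  have hf' : ∀ i x s, HasDerivAt (fun s : ℝ => f (x + s • b i)) (D i (x + s • b i)) s := by
    intro i x s
    have h1 := hf i (x + s • b i)
    have h2 : HasDerivAt (fun r : ℝ => r - s) 1 s := (hasDerivAt_id s).sub_const s
    rw [show (0 : ℝ) = s - s by simp] at h1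
    have h3 := HasDerivAt.comp s (h₂ := fun t : ℝ => f (x + s • b i + t • b i))
      (h := fun r : ℝ => r - s) h1 h2
    rw [mul_one] at h3
    convert! h3 using 1
    ext r
    simp only [Function.comp]
    congr 1
    module
  have mvt : ∀ i x (c : ℝ), ∃ θ ∈ Set.Ioo (0 : ℝ) 1,
      f (x + c • b i) - f x = c * D i (x + (θ * c) • b i) := by
    intro i x c
    have h1 : ∀ s, HasDerivAt (fun s : ℝ => f (x + (s * c) • b i))
        (D i (x + (s * c) • b i) * c) s := fun s => by
      have := HasDerivAt.comp s (hf' i x (s * c)) ((hasDerivAt_id s).mul_const c)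
      simpa [Function.comp_def] using this
    obtain ⟨θ, hθ, h⟩ := exists_hasDerivAt_eq_slope (fun s : ℝ => f (x + (s * c) • b i))
      (fun s => D i (x + (s * c) • b i) * c) zero_lt_one
      (fun s _ => (h1 s).continuousAt.continuousWithinAt) (fun s _ => h1 s)
    refine ⟨θ, hθ, ?_⟩
    simp at h
    linarith
  have key : ∀ s : Finset ι, (fun c : ι → ℝ => f (x + ∑ i ∈ s, c i • b i) - f x
      - ∑ i ∈ s, c i * D i x) =o[𝓝 0] (fun c => c) := by
    intro s
    induction s using Finset.induction_on with
    | empty => simp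
    | insert j s hj ih =>
      choose θ hθ h using fun c : ι → ℝ => mvt j (x + ∑ i ∈ s, c i • b i) (c j)
      have h2 : (fun c : ι → ℝ => c j * (D j (x + ∑ i ∈ s, c i • b i + (θ c * c j) • b j)
          - D j x)) =o[𝓝 0] (fun c => c) := by
        have t0 : Tendsto (fun c : ι → ℝ => θ c * c j) (𝓝 0) (𝓝 0) := by
          refine squeeze_zero_norm (a := fun c : ι → ℝ => ‖c j‖) (fun c => ?_) ?_
          · rw [norm_mul]
            refine mul_le_of_le_one_left (norm_nonneg _) ?_
            rw [Real.norm_eq_abs, abs_of_pos (hθ c).1]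
            exact (hθ c).2.le
          · have : Continuous fun c : ι → ℝ => ‖c j‖ := by fun_prop
            simpa using this.tendsto 0
        have t1 : Tendsto (fun c : ι → ℝ => x + ∑ i ∈ s, c i • b i + (θ c * c j) • b j)
            (𝓝 0) (𝓝 x) := by
          have a1 : Continuous fun c : ι → ℝ => x + ∑ i ∈ s, c i • b i := by fun_prop
          simpa using (a1.tendsto 0).add (t0.smul_const (b j))
        have t2 : Tendsto (fun c : ι → ℝ => D j (x + ∑ i ∈ s, c i • b i + (θ c * c j) • b j)
          - D j x) (𝓝 0) (𝓝 0) := by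
          simpa using (((hD j).tendsto x).comp t1).sub_const (D j x)
        have t3 : (fun c : ι → ℝ => c j) =O[𝓝 0] (fun c => c) :=
          Asymptotics.isBigO_of_le _ fun c => norm_le_pi_norm c j
        have := t3.norm_right.mul_isLittleO ((Asymptotics.isLittleO_one_iff ℝ).2 t2)
        simp only [mul_one] at this
        exact this.of_norm_right
      refine (ih.add h2).congr_left fun c => ?_
      rw [Finset.sum_insert hj, Finset.sum_insert hj, mul_sub, ← h c,
        show x + (c j • b j + ∑ i ∈ s, c i • b i) = x + ∑ i ∈ s, c i • b i + c j • b j by abel]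
      ring
  rw [hasFDerivAt_iff_isLittleO_nhds_zero]
  have t : Tendsto (fun h : E => b.equivFunL h) (𝓝 0) (𝓝 0) := by
    simpa using b.equivFunL.continuous.tendsto 0
  have := ((key Finset.univ).comp_tendsto t).trans_isBigO
    (b.equivFunL.toContinuousLinearMap.isBigO_id (𝓝 0))
  refine this.congr_left fun h => ?_
  have e : ∑ i, (b.equivFunL h) i • b i = h := b.sum_equivFun h
  simp only [Function.comp, e]
  congr 1
  simp [mul_comm]

theorem contDiff_succ_of_directional {E : Type*} [NormedAddCommGroup E]
    [NormedSpace ℝ E] [FiniteDimensional ℝ E] {ι : Type*} [Fintype ι]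
    (b : Module.Basis ι ℝ E) {f : E → ℝ} {D : ι → E → ℝ} {m : ℕ}
    (hD : ∀ i, ContDiff ℝ m (D i))
    (hf : ∀ i x, HasDerivAt (fun s : ℝ => f (x + s • b i)) (D i x) 0) :
    ContDiff ℝ (m + 1 : ℕ) f := by
  push_cast
  rw [contDiff_succ_iff_hasFDerivAt]
  refine ⟨fun x => ∑ i, D i x • LinearMap.toContinuousLinearMap (b.coord i), ?_,
    hasFDerivAt_of_continuous_directional b (fun i => (hD i).continuous) hf⟩
  exact ContDiff.sum fun i _ => (hD i).smul contDiff_const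

/-- The uniform measure on the unit cube `[0,1]^n`. -/
noncomputable def cubeMeasure (n : ℕ) : Measure (Fin n → ℝ) :=
  Measure.pi fun _ => volume.restrict (Set.Icc 0 1)

instance isProbabilityMeasure_restrict_Icc :
    IsProbabilityMeasure ((volume : Measure ℝ).restrict (Set.Icc 0 1)) :=
  ⟨by simp⟩

instance (n : ℕ) : IsProbabilityMeasure (cubeMeasure n) := by
  unfold cubeMeasure; infer_instance

/-- The distribution of `∑ k ∈ S, t k • w k` for `t` uniform in the unit cube. -/
noncomputable def zonoMeasure {d n : ℕ} (w : Fin n → Fin d → ℝ) (S : Finset (Fin n)) :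
    Measure (Fin d → ℝ) :=
  (cubeMeasure n).map fun t => ∑ k ∈ S, t k • w k

variable {d n : ℕ} (w : Fin n → Fin d → ℝ)

instance (S : Finset (Fin n)) : IsProbabilityMeasure (zonoMeasure w S) :=
  Measure.isProbabilityMeasure_map (Measurable.aemeasurable (by fun_prop))

theorem iIndepFun_eval_cubeMeasure (n : ℕ) :
    iIndepFun (fun (i : Fin n) (t : Fin n → ℝ) => t i) (cubeMeasure n) :=
  iIndepFun_pi (X := fun _ => id) fun _ => aemeasurable_id

theorem map_eval_cubeMeasure (i : Fin n) :
    (cubeMeasure n).map (fun t => t i) = volume.restrict (Set.Icc 0 1) :=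
  (measurePreserving_eval (fun _ : Fin n => (volume : Measure ℝ).restrict (Set.Icc 0 1)) i).map_eq

theorem map_precomp_cubeMeasure {e : Fin d → Fin n} (he : Function.Injective e) :
    (cubeMeasure n).map (fun t i => t (e i)) = cubeMeasure d := by
  have h := (iIndepFun_iff_map_fun_eq_pi_map (f := fun i (t : Fin n → ℝ) => t (e i))
    (fun i => (measurable_pi_apply _).aemeasurable)).1 ((iIndepFun_eval_cubeMeasure n).precomp he)
  rw [h]
  simp_rw [map_eval_cubeMeasure]
  rfl

theorem zonoMeasure_empty : zonoMeasure w ∅ = Measure.dirac 0 := by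
  simp [zonoMeasure]

theorem zonoMeasure_singleton (j : Fin n) :
    zonoMeasure w {j} = (volume.restrict (Set.Icc 0 1)).map fun t : ℝ => t • w j := by
  rw [← map_eval_cubeMeasure j, Measure.map_map (by fun_prop) (by fun_prop)]
  simp [zonoMeasure, Function.comp_def]

theorem zonoMeasure_image {e : Fin d → Fin n} (he : Function.Injective e) :
    zonoMeasure w (Finset.univ.image e) =
      (cubeMeasure d).map fun u => ∑ i, u i • w (e i) := by
  rw [← map_precomp_cubeMeasure he, Measure.map_map (by fun_prop) (by fun_prop)]
  simp only [zonoMeasure, Function.comp_def, Finset.sum_image he.injOn]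

theorem zonoMeasure_union {S T : Finset (Fin n)} (h : Disjoint S T) :
    zonoMeasure w (S ∪ T) = zonoMeasure w S ∗ zonoMeasure w T := by
  have h1 := ((iIndepFun_eval_cubeMeasure n).indepFun_finset S T h (fun i => by fun_prop)).comp
    (φ := fun t : S → ℝ => ∑ k, t k • w k) (ψ := fun t : T → ℝ => ∑ k, t k • w k)
    (by fun_prop) (by fun_prop)
  have h2 := h1.map_add_eq_map_conv_map (by fun_prop) (by fun_prop)
  have h3 : ∀ (S : Finset (Fin n)) (t : Fin n → ℝ),
      ∑ k : S, t k • w k = ∑ k ∈ S, t k • w k := fun S t =>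
    Finset.sum_coe_sort S fun k => t k • w k
  simp only [Function.comp_def, h3] at h2
  rw [zonoMeasure, zonoMeasure, zonoMeasure, ← h2]
  congr 1
  ext1 t
  rw [Finset.sum_union h]
  rfl

theorem withDensity_ofReal_conv {f : (Fin d → ℝ) → ℝ} (hf : Measurable f) (h0 : ∀ x, 0 ≤ f x)
    (ν : Measure (Fin d → ℝ)) [SFinite ν] (hi : ∀ x, Integrable (fun y => f (x - y)) ν) :
    (volume.withDensity fun x => ENNReal.ofReal (f x)) ∗ ν =
      volume.withDensity fun x => ENNReal.ofReal (∫ y, f (x - y) ∂ν) := by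
  have hf' : Measurable fun x => ENNReal.ofReal (f x) := by fun_prop
  refine Measure.ext_of_lintegral _ fun g hg => ?_
  rw [Measure.conv_comm, Measure.lintegral_conv hg]
  simp_rw [ofReal_integral_eq_lintegral_ofReal (hi _) (ae_of_all _ fun _ => h0 _)]
  rw [lintegral_withDensity_eq_lintegral_mul _ (by fun_prop) hg]
  calc ∫⁻ y, ∫⁻ x, g (y + x) ∂(volume.withDensity fun x => ENNReal.ofReal (f x)) ∂ν
      = ∫⁻ y, (∫⁻ x, ENNReal.ofReal (f (x - y)) * g x) ∂ν := by
        refine lintegral_congr fun y => ?_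
        rw [lintegral_withDensity_eq_lintegral_mul _ hf' (by fun_prop),
          ← lintegral_sub_right_eq_self _ y]
        simp
    _ = _ := by
        rw [lintegral_lintegral_swap (by fun_prop)]
        refine lintegral_congr fun x => ?_
        rw [Pi.mul_apply, lintegral_mul_const _ (by fun_prop)]

section Base

/-- The half-open parallelepiped `A [0,1)^d`, described through the inverse of `A`. -/
def parallelepipedIco (A : Matrix (Fin d) (Fin d) ℝ) : Set (Fin d → ℝ) :=
  A⁻¹.mulVec ⁻¹' Set.univ.pi fun _ => Set.Ico 0 1

theorem mem_parallelepipedIco {A : Matrix (Fin d) (Fin d) ℝ} {x : Fin d → ℝ} :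
    x ∈ parallelepipedIco A ↔ ∀ i, A⁻¹.mulVec x i ∈ Set.Ico (0 : ℝ) 1 := by
  simp [parallelepipedIco]

variable {A : Matrix (Fin d) (Fin d) ℝ}

theorem boxSplineBase_eq_indicator (hA : A.det ≠ 0) :
    boxSplineBase d A = (parallelepipedIco A).indicator
      fun _ => |A.det|⁻¹ := by
  have hu : IsUnit A.det := hA.isUnit
  classical
  ext x
  rw [boxSplineBase, Set.indicator_apply]
  refine if_congr ⟨?_, fun h => ⟨A⁻¹.mulVec x, ?_, ?_⟩⟩ rfl rfl
  · rintro ⟨u, hu', rfl⟩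
    simpa [mem_parallelepipedIco, Matrix.mulVec_mulVec, Matrix.nonsing_inv_mul _ hu] using hu'
  · simpa [mem_parallelepipedIco] using h
  · simp [Matrix.mulVec_mulVec, Matrix.mul_nonsing_inv _ hu]

theorem continuous_matrix_mulVec (A : Matrix (Fin d) (Fin d) ℝ) : Continuous A.mulVec :=
  A.mulVecLin.continuous_of_finiteDimensional

theorem measurableSet_parallelepipedIco :
    MeasurableSet (parallelepipedIco A) :=
  (continuous_matrix_mulVec _).measurable
    (MeasurableSet.univ_pi fun _ => measurableSet_Ico)

theorem measurable_boxSplineBase (hA : A.det ≠ 0) : Measurable (boxSplineBase d A) := by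
  rw [boxSplineBase_eq_indicator hA]
  exact measurable_const.indicator measurableSet_parallelepipedIco

theorem boxSplineBase_nonneg (x : Fin d → ℝ) : 0 ≤ boxSplineBase d A x := by
  unfold boxSplineBase
  split_ifs <;> positivity

theorem norm_boxSplineBase_le (x : Fin d → ℝ) : ‖boxSplineBase d A x‖ ≤ |A.det|⁻¹ := by
  unfold boxSplineBase
  split_ifs
  · simp
  · simp

theorem integrable_boxSplineBase_sub (hA : A.det ≠ 0) (ν : Measure (Fin d → ℝ))
    [IsFiniteMeasure ν] (x : Fin d → ℝ) : Integrable (fun y => boxSplineBase d A (x - y)) ν :=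
  Integrable.of_bound
    ((measurable_boxSplineBase hA).comp (measurable_const_sub x)).aestronglyMeasurable
    _ (ae_of_all _ fun _ => norm_boxSplineBase_le _)

theorem continuousAt_boxSplineBase (hA : A.det ≠ 0) {x : Fin d → ℝ}
    (h0 : ∀ i, A⁻¹.mulVec x i ≠ 0) (h1 : ∀ i, A⁻¹.mulVec x i ≠ 1) :
    ContinuousAt (boxSplineBase d A) x := by
  rw [boxSplineBase_eq_indicator hA]
  have hc : ∀ i, ContinuousAt (fun z => A⁻¹.mulVec z i) x := fun i =>
    ((continuous_apply i).comp (continuous_matrix_mulVec A⁻¹)).continuousAt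
  by_cases hin : ∀ i, A⁻¹.mulVec x i ∈ Set.Ioo (0 : ℝ) 1
  · have h : ∀ᶠ z in 𝓝 x, ∀ i, A⁻¹.mulVec z i ∈ Set.Ioo (0 : ℝ) 1 :=
      eventually_all.2 fun i => (hc i).eventually_mem (isOpen_Ioo.mem_nhds (hin i))
    refine (continuousAt_const (y := |A.det|⁻¹)).congr ?_
    filter_upwards [h] with z hz
    rw [Set.indicator_of_mem]
    exact mem_parallelepipedIco.2 fun i => Set.Ioo_subset_Ico_self (hz i)
  · push Not at hin
    obtain ⟨i, hi⟩ := hin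
    have hi' : A⁻¹.mulVec x i ∈ (Set.Icc (0 : ℝ) 1)ᶜ := fun h =>
      hi ⟨h.1.lt_of_ne' (h0 i), h.2.lt_of_ne (h1 i)⟩
    refine (continuousAt_const (y := (0 : ℝ))).congr ?_
    filter_upwards [(hc i).eventually_mem (isClosed_Icc.isOpen_compl.mem_nhds hi')] with z hz
    rw [Set.indicator_of_notMem]
    exact fun h => hz (Set.Ico_subset_Icc_self (mem_parallelepipedIco.1 h i))

theorem cubeMeasure_eq_restrict (n : ℕ) :
    cubeMeasure n = volume.restrict (Set.univ.pi fun _ => Set.Ico 0 1) := by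
  rw [cubeMeasure, Measure.restrict_congr_set Ico_ae_eq_Icc.symm, ← Measure.restrict_pi_pi]
  rfl

theorem map_mulVec_cubeMeasure (hA : A.det ≠ 0) :
    (cubeMeasure d).map A.mulVec =
      volume.withDensity fun x => ENNReal.ofReal (boxSplineBase d A x) := by
  have hm : Measurable A.mulVec := (continuous_matrix_mulVec A).measurable
  have hpre : (Set.univ.pi fun _ : Fin d => Set.Ico (0 : ℝ) 1) =
      A.mulVec ⁻¹' (parallelepipedIco A) := by
    ext u
    simp [mem_parallelepipedIco, Matrix.mulVec_mulVec, Matrix.nonsing_inv_mul _ hA.isUnit]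
  have hind : (fun x => ENNReal.ofReal (boxSplineBase d A x)) =
      (parallelepipedIco A).indicator
      fun _ => ENNReal.ofReal |A.det|⁻¹ := by
    classical
    ext x
    rw [boxSplineBase_eq_indicator hA, Set.indicator_apply, Set.indicator_apply]
    split_ifs <;> simp
  rw [hind, withDensity_indicator measurableSet_parallelepipedIco, withDensity_const,
    cubeMeasure_eq_restrict, hpre,
    ← Measure.restrict_map hm measurableSet_parallelepipedIco]
  have := Real.map_matrix_volume_pi_eq_smul_volume_pi hA
  rw [← Measure.restrict_smul, ← abs_inv, ← this]
  rfl

end Base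

/-- The matrix with columns `w (e 0), …, w (e (d-1))`. -/
def colMatrix (e : Fin d → Fin n) : Matrix (Fin d) (Fin d) ℝ :=
  Matrix.of fun i j => w (e j) i

theorem colMatrix_mulVec (e : Fin d → Fin n) (u : Fin d → ℝ) :
    (colMatrix w e).mulVec u = ∑ i, u i • w (e i) := by
  ext i
  simp [colMatrix, Matrix.mulVec, dotProduct, mul_comm]

theorem zonoMeasure_image_eq_withDensity {e : Fin d → Fin n} (he : Function.Injective e)
    (hdet : (colMatrix w e).det ≠ 0) :
    zonoMeasure w (Finset.univ.image e) =
      volume.withDensity fun x => ENNReal.ofReal (boxSplineBase d (colMatrix w e) x) := by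
  rw [zonoMeasure_image w he, ← map_mulVec_cubeMeasure hdet]
  congr 1
  ext1 u
  exact (colMatrix_mulVec w e u).symm

theorem zonoMeasure_eq_withDensity {e : Fin d → Fin n} (he : Function.Injective e)
    (hdet : (colMatrix w e).det ≠ 0) {S : Finset (Fin n)} (hS : Finset.univ.image e ⊆ S) :
    zonoMeasure w S = volume.withDensity fun x => ENNReal.ofReal
      (∫ y, boxSplineBase d (colMatrix w e) (x - y) ∂zonoMeasure w (S \ Finset.univ.image e)) := by
  conv_lhs => rw [← Finset.union_sdiff_of_subset hS]
  rw [zonoMeasure_union w Finset.disjoint_sdiff, zonoMeasure_image_eq_withDensity w he hdet]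
  exact withDensity_ofReal_conv (measurable_boxSplineBase hdet) boxSplineBase_nonneg _
    (integrable_boxSplineBase_sub hdet _)

theorem ae_zonoMeasure_ne {S : Finset (Fin n)} (ℓ : (Fin d → ℝ) →ₗ[ℝ] ℝ)
    (h : ∃ k ∈ S, ℓ (w k) ≠ 0) (c : ℝ) : ∀ᵐ y ∂zonoMeasure w S, ℓ y ≠ c := by
  obtain ⟨k, hk, hℓ⟩ := h
  have hm : MeasurableSet {y | ℓ y = c} :=
    (isClosed_singleton.preimage ℓ.continuous_of_finiteDimensional).measurableSet
  have hS : S = S.erase k ∪ {k} := by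
    ext j
    by_cases hj : j = k <;> simp [hj, hk]
  rw [hS, zonoMeasure_union w (by simp), zonoMeasure_singleton, ae_iff]
  simp only [not_not]
  rw [← lintegral_indicator_one hm, Measure.lintegral_conv (measurable_one.indicator hm)]
  refine (lintegral_congr fun x => ?_).trans lintegral_zero
  have hmx : Measurable fun y => {y | ℓ y = c}.indicator (1 : (Fin d → ℝ) → ENNReal) (x + y) :=
    (measurable_one.indicator hm).comp (measurable_const_add x)
  rw [lintegral_map hmx (by fun_prop)]
  have hsub : {t : ℝ | ℓ (x + t • w k) = c}.Subsingleton := by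
    intro s hs t ht
    simp only [Set.mem_ofPred_eq, map_add, map_smul, smul_eq_mul] at hs ht
    exact mul_right_cancel₀ hℓ (by linarith)
  have h0 : (volume.restrict (Set.Icc (0 : ℝ) 1)) {t : ℝ | ℓ (x + t • w k) = c} = 0 :=
    hsub.measure_zero (volume.restrict (Set.Icc (0 : ℝ) 1))
  refine (lintegral_congr_ae (g := fun _ => (0 : ENNReal)) ?_).trans lintegral_zero
  filter_upwards [measure_eq_zero_iff_ae_notMem.1 h0] with t ht
  exact Set.indicator_of_notMem (s := {y | ℓ y = c}) (a := x + t • w k) ht 1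

theorem continuous_integral_boxSplineBase {e : Fin d → Fin n}
    (hdet : (colMatrix w e).det ≠ 0) {S : Finset (Fin n)}
    (hS : ∀ i, ∃ k ∈ S, (colMatrix w e)⁻¹.mulVec (w k) i ≠ 0) :
    Continuous fun x => ∫ y, boxSplineBase d (colMatrix w e) (x - y) ∂zonoMeasure w S := by
  rw [continuous_iff_continuousAt]
  intro x
  refine continuousAt_of_dominated (bound := fun _ => |(colMatrix w e).det|⁻¹)
    (.of_forall fun z => (integrable_boxSplineBase_sub hdet _ z).aestronglyMeasurable)
    (.of_forall fun z => ae_of_all _ fun y => norm_boxSplineBase_le _) (integrable_const _) ?_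
  have h : ∀ c : ℝ, ∀ᵐ y ∂zonoMeasure w S, ∀ i,
      (colMatrix w e)⁻¹.mulVec (x - y) i ≠ c := by
    intro c
    rw [ae_all_iff]
    intro i
    filter_upwards [ae_zonoMeasure_ne w (LinearMap.proj i ∘ₗ (colMatrix w e)⁻¹.mulVecLin)
      (hS i) ((colMatrix w e)⁻¹.mulVec x i - c)] with y hy hxy
    refine hy ?_
    rw [Matrix.mulVec_sub, Pi.sub_apply] at hxy
    simp only [LinearMap.comp_apply, Matrix.mulVecLin_apply, LinearMap.proj_apply]
    linarith
  filter_upwards [h 0, h 1] with y h0 h1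
  exact ContinuousAt.comp (f := fun x => x - y) (continuousAt_boxSplineBase hdet h0 h1)
    (by fun_prop)

theorem integral_zonoMeasure_singleton {g : (Fin d → ℝ) → ℝ} (hg : Measurable g) (j : Fin n)
    (x : Fin d → ℝ) :
    ∫ y, g (x - y) ∂zonoMeasure w {j} = ∫ t in (0 : ℝ)..1, g (x - t • w j) := by
  have hgx : Measurable fun y => g (x - y) := hg.comp (measurable_const_sub x)
  rw [zonoMeasure_singleton, integral_map (by fun_prop) hgx.aestronglyMeasurable,
    intervalIntegral.integral_of_le zero_le_one, integral_Icc_eq_integral_Ioc]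

theorem continuous_integral_zonoMeasure_singleton {g : (Fin d → ℝ) → ℝ} (hg : Continuous g)
    (j : Fin n) : Continuous fun x => ∫ y, g (x - y) ∂zonoMeasure w {j} := by
  simp_rw [integral_zonoMeasure_singleton w hg.measurable]
  exact intervalIntegral.continuous_parametric_intervalIntegral_of_continuous' (by fun_prop) _ _

theorem hasDerivAt_integral_zonoMeasure_singleton {g : (Fin d → ℝ) → ℝ} (hg : Continuous g)
    (j : Fin n) (x : Fin d → ℝ) :
    HasDerivAt (fun s : ℝ => ∫ y, g (x + s • w j - y) ∂zonoMeasure w {j})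
      (g x - g (x - w j)) 0 := by
  set G : ℝ → ℝ := fun r => g (x + r • w j) with hG
  have hGc : Continuous G := by fun_prop
  have heq : (fun s : ℝ => ∫ y, g (x + s • w j - y) ∂zonoMeasure w {j}) =
      fun s => (∫ r in (0 : ℝ)..s, G r) - ∫ r in (0 : ℝ)..(s - 1), G r := by
    ext s
    rw [integral_zonoMeasure_singleton w hg.measurable, intervalIntegral.integral_interval_sub_left
      (hGc.intervalIntegrable _ _) (hGc.intervalIntegrable _ _)]
    have := intervalIntegral.integral_comp_sub_left (a := 0) (b := 1) G s
    rw [sub_zero] at this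
    rw [← this]
    refine intervalIntegral.integral_congr fun t _ => ?_
    simp only [hG]
    congr 1
    module
  rw [heq]
  have h1 := hGc.integral_hasStrictDerivAt 0 0 |>.hasDerivAt
  have h2 := HasDerivAt.comp (0 : ℝ) (h := fun s : ℝ => s - 1)
    (hGc.integral_hasStrictDerivAt 0 (0 - 1)).hasDerivAt ((hasDerivAt_id (0 : ℝ)).sub_const 1)
  convert! h1.sub h2 using 1
  simp [hG, sub_eq_add_neg]

theorem integrable_comp_sub_zonoMeasure_singleton {g : (Fin d → ℝ) → ℝ} (hg : Continuous g)
    (j : Fin n) (x : Fin d → ℝ) : Integrable (fun y => g (x - y)) (zonoMeasure w {j}) := by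
  rw [zonoMeasure_singleton, integrable_map_measure
    (by fun_prop) (by fun_prop)]
  exact (Continuous.continuousOn (by fun_prop)).integrableOn_compact isCompact_Icc

theorem eq_of_withDensity_ofReal_eq {f g : (Fin d → ℝ) → ℝ} (hf : Continuous f)
    (hg : Continuous g) (hf0 : ∀ x, 0 ≤ f x) (hg0 : ∀ x, 0 ≤ g x)
    (h : (volume.withDensity fun x => ENNReal.ofReal (f x)) =
      volume.withDensity fun x => ENNReal.ofReal (g x)) : f = g := by
  have hf' : Continuous fun x => ENNReal.ofReal (f x) :=
    ENNReal.continuous_ofReal.comp hf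
  have hg' : Continuous fun x => ENNReal.ofReal (g x) :=
    ENNReal.continuous_ofReal.comp hg
  rw [withDensity_eq_iff_of_sigmaFinite hf'.aemeasurable hg'.aemeasurable,
    hf'.ae_eq_iff_eq _ hg'] at h
  ext x
  exact (ENNReal.ofReal_eq_ofReal_iff (hf0 x) (hg0 x)).1 (congrFun h x)

/-- The vectors `w k`, `k ∈ S`, still span after removing fewer than `m` of them. -/
def SpansRobustly (S : Finset (Fin n)) (m : ℕ) : Prop :=
  ∀ T : Finset (Fin n), T.card < m →
    Submodule.span ℝ (w '' (S \ T : Finset (Fin n))) = (⊤ : Submodule ℝ (Fin d → ℝ))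

variable {w}

theorem SpansRobustly.mono {S : Finset (Fin n)} {m m' : ℕ} (h : SpansRobustly w S m)
    (hm : m' ≤ m) : SpansRobustly w S m' :=
  fun T hT => h T (hT.trans_le hm)

theorem SpansRobustly.erase {S : Finset (Fin n)} {m : ℕ} (h : SpansRobustly w S (m + 1))
    (j : Fin n) : SpansRobustly w (S.erase j) m := by
  intro T hT
  have : S.erase j \ T = S \ insert j T := by
    ext k
    simp only [Finset.mem_sdiff, Finset.mem_erase, Finset.mem_insert]
    tauto
  rw [this]
  exact h _ ((Finset.card_insert_le _ _).trans_lt (by omega))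

theorem det_colMatrix_ne_zero_iff {e : Fin d → Fin n} :
    (colMatrix w e).det ≠ 0 ↔ LinearIndependent ℝ (w ∘ e) := by
  rw [← isUnit_iff_ne_zero, ← Matrix.isUnit_iff_isUnit_det,
    ← Matrix.linearIndependent_cols_iff_isUnit]
  rfl

theorem exists_det_colMatrix_ne_zero {S : Finset (Fin n)}
    (h : Submodule.span ℝ (w '' S) = (⊤ : Submodule ℝ (Fin d → ℝ))) :
    ∃ e : Fin d → Fin n, Function.Injective e ∧ Finset.univ.image e ⊆ S ∧
      (colMatrix w e).det ≠ 0 := by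
  obtain ⟨κ, a, ha, hspan, hli⟩ := exists_linearIndependent' ℝ (fun k : S => w k)
  have : Finite κ := Finite.of_injective a ha
  have := Fintype.ofFinite κ
  have htop : Submodule.span ℝ (Set.range ((fun k : S => w k) ∘ a)) = ⊤ := by
    rw [hspan, ← h]
    congr 1
    ext y
    simp
  have hcard : Fintype.card κ = d := by
    rw [← Module.finrank_eq_card_basis (Module.Basis.mk hli htop.ge)]
    simp
  let σ : Fin d ≃ κ := (Fintype.equivFinOfCardEq hcard).symm
  refine ⟨fun i => a (σ i), Subtype.val_injective.comp (ha.comp σ.injective), ?_,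
    det_colMatrix_ne_zero_iff.2 (hli.comp σ σ.injective)⟩
  intro k
  simp only [Finset.mem_image, Finset.mem_univ, true_and]
  rintro ⟨i, rfl⟩
  exact (a (σ i)).2

theorem inv_colMatrix_mulVec {e : Fin d → Fin n} (hdet : (colMatrix w e).det ≠ 0) (j : Fin d) :
    (colMatrix w e)⁻¹.mulVec (w (e j)) = Pi.single j 1 := by
  have h : w (e j) = (colMatrix w e).mulVec (Pi.single j 1) := by
    rw [Matrix.mulVec_single_one]
    rfl
  rw [h, Matrix.mulVec_mulVec, Matrix.nonsing_inv_mul _ hdet.isUnit, Matrix.one_mulVec]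

theorem SpansRobustly.exists_inv_colMatrix_mulVec_ne_zero {S : Finset (Fin n)}
    (h : SpansRobustly w S 2) {e : Fin d → Fin n} (hdet : (colMatrix w e).det ≠ 0) (i : Fin d) :
    ∃ k ∈ S \ Finset.univ.image e, (colMatrix w e)⁻¹.mulVec (w k) i ≠ 0 := by
  by_contra! hcon
  let ℓ : (Fin d → ℝ) →ₗ[ℝ] ℝ := LinearMap.proj i ∘ₗ (colMatrix w e)⁻¹.mulVecLin
  have hker : Submodule.span ℝ (w '' (S \ {e i} : Finset (Fin n))) ≤ LinearMap.ker ℓ := by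
    rw [Submodule.span_le]
    rintro _ ⟨k, hk, rfl⟩
    simp only [Finset.coe_sdiff, Finset.coe_singleton, Set.mem_sdiff, Finset.mem_coe,
      Set.mem_singleton_iff] at hk
    change (colMatrix w e)⁻¹.mulVec (w k) i = 0
    by_cases hke : k ∈ Finset.univ.image e
    · obtain ⟨j, -, rfl⟩ := Finset.mem_image.1 hke
      rw [inv_colMatrix_mulVec hdet, Pi.single_eq_of_ne]
      rintro rfl
      exact hk.2 rfl
    · exact hcon k (Finset.mem_sdiff.2 ⟨hk.1, hke⟩)
  rw [h {e i} (by simp)] at hker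
  have h1 : (colMatrix w e)⁻¹.mulVec (w (e i)) i = 0 := hker (Submodule.mem_top (x := w (e i)))
  rw [inv_colMatrix_mulVec hdet, Pi.single_eq_same] at h1
  exact one_ne_zero h1

theorem SpansRobustly.exists_continuous_density {S : Finset (Fin n)} (h : SpansRobustly w S 2) :
    ∃ f : (Fin d → ℝ) → ℝ, Continuous f ∧ (∀ x, 0 ≤ f x) ∧
      zonoMeasure w S = volume.withDensity fun x => ENNReal.ofReal (f x) := by
  obtain ⟨e, he, heS, hdet⟩ := exists_det_colMatrix_ne_zero (w := w) (S := S)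
    (by simpa using h ∅ (by simp))
  exact ⟨_, continuous_integral_boxSplineBase w hdet
    (h.exists_inv_colMatrix_mulVec_ne_zero hdet),
    fun x => integral_nonneg fun y => boxSplineBase_nonneg _,
    zonoMeasure_eq_withDensity w he hdet heS⟩

theorem SpansRobustly.exists_contDiff_density (m : ℕ) {S : Finset (Fin n)}
    (h : SpansRobustly w S (m + 2)) :
    ∃ f : (Fin d → ℝ) → ℝ, ContDiff ℝ m f ∧ (∀ x, 0 ≤ f x) ∧
      zonoMeasure w S = volume.withDensity fun x => ENNReal.ofReal (f x) := by
  induction m generalizing S with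
  | zero =>
    obtain ⟨f, hf, hf'⟩ := h.exists_continuous_density
    exact ⟨f, by simpa [contDiff_zero] using hf, hf'⟩
  | succ m ih =>
    obtain ⟨f, hf, hf0, hfS⟩ := (h.mono (by omega : 2 ≤ m + 1 + 2)).exists_continuous_density
    refine ⟨f, ?_, hf0, hfS⟩
    choose g hg hg0 hgS using fun j => ih (h.erase j)
    have hfg : ∀ j ∈ S, f = fun x => ∫ y, g j (x - y) ∂zonoMeasure w {j} := by
      intro j hj
      refine eq_of_withDensity_ofReal_eq hf
        (continuous_integral_zonoMeasure_singleton w (hg j).continuous j) hf0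
        (fun x => integral_nonneg fun y => hg0 j _) ?_
      have hS : S = S.erase j ∪ {j} := by
        ext k
        by_cases hk : k = j <;> simp [hk, hj]
      rw [← hfS, ← withDensity_ofReal_conv (hg j).continuous.measurable (hg0 j) _
        (integrable_comp_sub_zonoMeasure_singleton w (hg j).continuous j), ← hgS j,
        ← zonoMeasure_union w (by simp), ← hS]
    obtain ⟨e, he, heS, hdet⟩ := exists_det_colMatrix_ne_zero (w := w) (S := S)
      (by simpa using h ∅ (by simp))
    let b : Module.Basis (Fin d) ℝ (Fin d → ℝ) :=
      basisOfLinearIndependentOfCardEqFinrank' (w ∘ e) (det_colMatrix_ne_zero_iff.1 hdet) (by simp)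
    have hb : ∀ i, b i = w (e i) := fun i => by simp [b]
    refine contDiff_succ_of_directional b
      (D := fun i x => g (e i) x - g (e i) (x - w (e i))) (fun i => ?_) fun i x => ?_
    · exact (hg _).sub ((hg _).comp (contDiff_id.sub contDiff_const))
    · rw [hb, hfg (e i) (heS (Finset.mem_image_of_mem e (Finset.mem_univ i)))]
      exact hasDerivAt_integral_zonoMeasure_singleton w (hg _).continuous _ _

theorem boxSpline_castLE_eq_integral {w : Fin n → Fin d → ℝ} (hdn : d ≤ n)
    (hdet : (leadMat d n hdn w).det ≠ 0) (m : ℕ) (hdm : d ≤ m) (hm : m ≤ n) (x : Fin d → ℝ) :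
    boxSpline d m (fun k => w (Fin.castLE hm k)) x =
      ∫ y, boxSplineBase d (leadMat d n hdn w) (x - y)
        ∂zonoMeasure w {k : Fin n | d ≤ (k : ℕ) ∧ (k : ℕ) < m} := by
  induction m, hdm using Nat.le_induction generalizing x with
  | base =>
    have : ({k : Fin n | d ≤ (k : ℕ) ∧ (k : ℕ) < d} : Finset (Fin n)) = ∅ := by
      ext k; simp
    rw [this, zonoMeasure_empty, integral_dirac, boxSpline, dif_pos rfl, sub_zero]
    rfl
  | succ m hdm ih =>
    have hset : ({k : Fin n | d ≤ (k : ℕ) ∧ (k : ℕ) < m + 1} : Finset (Fin n)) =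
        {⟨m, hm⟩} ∪ ({k : Fin n | d ≤ (k : ℕ) ∧ (k : ℕ) < m} : Finset (Fin n)) := by
      ext k
      simp only [Finset.mem_filter, Finset.mem_univ, true_and, Finset.mem_union,
        Finset.mem_singleton, Fin.ext_iff]
      omega
    have hint := integrable_boxSplineBase_sub hdet
      (zonoMeasure w {⟨m, hm⟩} ∗
        zonoMeasure w ({k : Fin n | d ≤ (k : ℕ) ∧ (k : ℕ) < m} : Finset (Fin n))) x
    rw [hset, zonoMeasure_union w (by simp), integral_conv hint, boxSpline,
      dif_neg (by omega), dif_neg (by omega)]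
    have hmeas : Measurable fun v => ∫ y, boxSplineBase d (leadMat d n hdn w) (v - y)
        ∂zonoMeasure w {k : Fin n | d ≤ (k : ℕ) ∧ (k : ℕ) < m} := by
      have h2 : Measurable fun p : (Fin d → ℝ) × (Fin d → ℝ) =>
          boxSplineBase d (leadMat d n hdn w) (p.1 - p.2) :=
        (measurable_boxSplineBase hdet).comp (measurable_fst.sub measurable_snd)
      exact h2.stronglyMeasurable.integral_prod_right.measurable
    simp_rw [← sub_sub]
    rw [integral_zonoMeasure_singleton w hmeas]
    refine intervalIntegral.integral_congr fun t _ => ?_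
    exact ih (by omega) _

theorem spansRobustly_rhoXi (w : Fin n → Fin d → ℝ) :
    SpansRobustly w Finset.univ (rhoXi d n w) := by
  intro T hT
  by_contra h
  have hmem : T.card ∈ {m : ℕ | ∃ S : Finset (Fin n), S.card = m ∧
      Submodule.span ℝ (w '' ↑(Sᶜ)) ≠ (⊤ : Submodule ℝ (Fin d → ℝ))} :=
    ⟨T, rfl, by rwa [Finset.compl_eq_univ_sdiff]⟩
  exact absurd (Nat.sInf_le hmem) (not_le.2 hT)

end Auxiliary

/-- If `ρ(Ξ) ≥ 2`, the box spline `M_Ξ` is `ρ(Ξ) - 2` times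
continuously differentiable on `ℝ^d`. -/
theorem boxSpline_contDiff (d n : ℕ) (hdn : d ≤ n)
    (v : Fin n → Fin d → ℤ) (hv : ∀ k, v k ≠ 0)
    (hns : (leadMat d n hdn (intCols d n v)).det ≠ 0)
    (hρ : 2 ≤ rhoXi d n (intCols d n v)) :
    ContDiff ℝ ((rhoXi d n (intCols d n v) - 2 : ℕ) : ℕ∞)
      (boxSpline d n (intCols d n v)) := by
  set w := intCols d n v
  have hR := spansRobustly_rhoXi w
  have he : Function.Injective (Fin.castLE hdn) := Fin.castLE_injective hdn
  have hdet : (colMatrix w (Fin.castLE hdn)).det ≠ 0 := hns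
  have hset : ({k : Fin n | d ≤ (k : ℕ) ∧ (k : ℕ) < n} : Finset (Fin n)) =
      Finset.univ \ Finset.univ.image (Fin.castLE hdn) := by
    ext k
    simp only [Finset.mem_filter, Finset.mem_univ, true_and, Finset.mem_sdiff, Finset.mem_image,
      k.2, and_true]
    constructor
    · rintro hk ⟨i, rfl⟩
      exact absurd i.2 (not_lt.2 hk)
    · intro hk
      by_contra hlt
      exact hk ⟨⟨k, by omega⟩, rfl⟩
  have hbox : boxSpline d n w = fun x => ∫ y, boxSplineBase d (colMatrix w (Fin.castLE hdn))
      (x - y) ∂zonoMeasure w (Finset.univ \ Finset.univ.image (Fin.castLE hdn)) := by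
    ext x
    rw [← hset]
    exact boxSpline_castLE_eq_integral hdn hns n hdn le_rfl x
  obtain ⟨f, hf, hf0, hfS⟩ := SpansRobustly.exists_contDiff_density (rhoXi d n w - 2)
    (hR.mono (by omega))
  have hfbox : boxSpline d n w = f := by
    rw [hbox]
    refine eq_of_withDensity_ofReal_eq
      (continuous_integral_boxSplineBase w hdet
        ((hR.mono hρ).exists_inv_colMatrix_mulVec_ne_zero hdet))
      hf.continuous (fun x => integral_nonneg fun y => boxSplineBase_nonneg _) hf0 ?_
    rw [← hfS]
    exact (zonoMeasure_eq_withDensity w he hdet (Finset.subset_univ _)).symm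
  rw [hfbox]
  exact hf
end

section
/- Let Ξ = [v_1 ⋯ v_n] be a matrix of direction vectors v_k ∈ ℤ^d ∖ {0} with n ≥ d and Ξ_d := [v_1 ⋯ v_d] nonsingular. Define the mesh Δ(Ξ) := ℍ(Ξ) + ℤ^d, where ℍ(Ξ) is the union of all hyperplanes spanned by the columns of any submatrix X of Ξ with rank(X) = d − 1. Then the box spline M_Ξ is a piecewise polynomial of total degree n − d over Δ(Ξ): on every connected component U of ℝ^d ∖ Δ(Ξ) there exists a polynomial p in d variables with total degree at most n − d such that M_Ξ(x) = p(x) for all x ∈ U. -/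
open MeasureTheory

/-- `ℍ(Ξ)`: the union of all hyperplanes spanned by the columns of a submatrix `X` of `Ξ`
of rank `d - 1`. -/
noncomputable def hyperSet (d n : ℕ) (w : Fin n → Fin d → ℝ) : Set (Fin d → ℝ) :=
  {x | ∃ S : Finset (Fin n),
    Module.finrank ℝ (Submodule.span ℝ (w '' ↑S)) = d - 1 ∧
    x ∈ Submodule.span ℝ (w '' ↑S)}

/-- `Δ(Ξ) = ℍ(Ξ) + ℤ^d`: all integer shifts of the hyperplanes in `ℍ(Ξ)`. -/
noncomputable def meshSet (d n : ℕ) (w : Fin n → Fin d → ℝ) : Set (Fin d → ℝ) :=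
  {x | ∃ h ∈ hyperSet d n w, ∃ i : Fin d → ℤ, x = h + fun j => (i j : ℝ)}

namespace MvPolynomial

lemma totalDegree_aeval_le {σ τ R : Type*} [CommSemiring R] (p : MvPolynomial σ R)
    {g : σ → MvPolynomial τ R} (hg : ∀ i, (g i).totalDegree ≤ 1) :
    (aeval g p).totalDegree ≤ p.totalDegree := by
  rw [aeval_def, eval₂_eq]
  refine totalDegree_finsetSum_le fun s hs => ?_
  refine (totalDegree_mul _ _).trans ?_
  rw [algebraMap_eq, totalDegree_C, zero_add]
  refine (totalDegree_finsetProd _ _).trans (le_trans ?_ (le_totalDegree hs))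
  refine Finset.sum_le_sum fun i _ => (totalDegree_pow _ _).trans ?_
  simpa using Nat.mul_le_mul_left (s i) (hg i)

/-- Degree-preserving substitution of degree-one polynomials, at the level of functions. -/
lemma exists_eval_comp {σ τ R : Type*} [CommSemiring R] (p : MvPolynomial σ R)
    {φ : (τ → R) → σ → R}
    (hφ : ∀ i, ∃ q : MvPolynomial τ R, q.totalDegree ≤ 1 ∧ ∀ x, φ x i = eval x q) :
    ∃ q : MvPolynomial τ R, q.totalDegree ≤ p.totalDegree ∧ ∀ x, eval x q = eval (φ x) p := by
  choose g hg hφg using hφ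
  refine ⟨aeval g p, totalDegree_aeval_le p hg, fun x => ?_⟩
  rw [← coe_aeval_eq_eval, ← coe_aeval_eq_eval]
  simp only [RingHom.coe_coe]
  rw [← AlgHom.comp_apply, comp_aeval]
  congr 2
  funext i
  simpa using (hφg i x).symm

lemma exists_pderiv_eq {σ : Type*} (i : σ) (q : MvPolynomial σ ℝ) :
    ∃ P : MvPolynomial σ ℝ, P.totalDegree ≤ q.totalDegree + 1 ∧ pderiv i P = q := by
  classical
  refine ⟨∑ s ∈ q.support, monomial (s + Finsupp.single i 1) (coeff s q / (s i + 1)), ?_, ?_⟩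
  · refine totalDegree_finsetSum_le fun s hs => (totalDegree_monomial_le _ _).trans ?_
    have h := le_totalDegree hs
    rw [Finsupp.sum_add_index' (by simp) (by simp)]
    simpa [Finsupp.sum] using h
  · rw [map_sum]
    conv_rhs => rw [q.as_sum]
    refine Finset.sum_congr rfl fun s _ => ?_
    rw [pderiv_monomial]
    have : (s i + 1 : ℝ) ≠ 0 := by positivity
    congr 1
    · simp
    · simp [field]

lemma hasLineDerivAt_eval {σ : Type*} [DecidableEq σ] (p : MvPolynomial σ ℝ)
    (s : σ → ℝ) (i : σ) :
    HasLineDerivAt ℝ (fun x => eval x p) (eval s (pderiv i p)) s (Pi.single i 1) := by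
  unfold HasLineDerivAt
  induction p using MvPolynomial.induction_on with
  | C a => simpa using hasDerivAt_const (0 : ℝ) a
  | add p q hp hq => simpa using hp.fun_add hq
  | mul_X p j hp =>
    have hX : HasDerivAt (fun t : ℝ => (s + t • (Pi.single i 1 : σ → ℝ)) j)
        ((Pi.single i 1 : σ → ℝ) j) 0 := by
      simpa using ((hasDerivAt_id (0 : ℝ)).mul_const ((Pi.single i 1 : σ → ℝ) j)).const_add (s j)
    have := hp.fun_mul hX
    rw [Derivation.leibniz, pderiv_X]
    simp only [map_mul, eval_X, map_add, smul_eq_mul]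
    simp only [zero_smul, add_zero] at this
    have hj : eval s ((Pi.single i 1 : σ → MvPolynomial σ ℝ) j) = (Pi.single i 1 : σ → ℝ) j := by
      rcases eq_or_ne j i with rfl | h
      · simp
      · simp [Pi.single_eq_of_ne h]
    refine this.congr_deriv ?_
    rw [hj]
    ring

lemma eq_of_eventuallyEq_eval {σ : Type*} [Finite σ] {p q : MvPolynomial σ ℝ} {x : σ → ℝ}
    (h : (fun y => eval y p) =ᶠ[nhds x] fun y => eval y q) : p = q := by
  have := Fintype.ofFinite σ
  obtain ⟨ε, hε, hball⟩ := Metric.eventually_nhds_iff_ball.1 h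
  refine funext_set (fun i => Metric.ball (x i) ε) (fun i => ?_) fun y hy => hball y ?_
  · rw [Real.ball_eq_Ioo]
    exact Set.Ioo_infinite (by linarith)
  · rwa [ball_pi _ hε]

end MvPolynomial

open MvPolynomial in
/-- A function whose partial derivatives on a ball are polynomials of degree less than `m`
(or zero) is a polynomial of degree at most `m` there. -/
lemma exists_eval_eq_of_hasLineDerivAt {ι : Type*} [Fintype ι] [DecidableEq ι] {m : ℕ} {r : ℝ}
    (hr : 0 < r) {F : (ι → ℝ) → ℝ} {P : ι → MvPolynomial ι ℝ}
    (hP : ∀ i, (P i).totalDegree ≤ m)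
    (hF : ∀ s ∈ Metric.ball (0 : ι → ℝ) r, ∀ i,
      HasLineDerivAt ℝ F (eval s (pderiv i (P i))) s (Pi.single i 1)) :
    ∃ p : MvPolynomial ι ℝ, p.totalDegree ≤ m ∧
      ∀ s ∈ Metric.ball (0 : ι → ℝ) r, F s = eval s p := by
  suffices H : ∀ K : Finset ι, ∃ p : MvPolynomial ι ℝ, p.totalDegree ≤ m ∧
      ∀ s ∈ Metric.ball (0 : ι → ℝ) r, (∀ i ∉ K, s i = 0) → F s = eval s p by
    obtain ⟨p, hp, h⟩ := H Finset.univ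
    exact ⟨p, hp, fun s hs => h s hs (by simp)⟩
  intro K
  induction K using Finset.induction_on with
  | empty =>
    refine ⟨C (F 0), by simp, fun s _ h => ?_⟩
    rw [show s = 0 from funext fun i => h i (by simp)]
    simp
  | insert j K _ ih =>
    obtain ⟨p, hp, h⟩ := ih
    have hφ : ∀ i, ∃ q : MvPolynomial ι ℝ, q.totalDegree ≤ 1 ∧
        ∀ x : ι → ℝ, Function.update x j 0 i = eval x q := by
      intro i
      rcases eq_or_ne i j with rfl | hij
      · exact ⟨0, by simp, by simp⟩
      · exact ⟨X i, by simp, fun x => by simp [hij]⟩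
    obtain ⟨p₁, hp₁, h₁⟩ := exists_eval_comp p hφ
    obtain ⟨p₂, hp₂, h₂⟩ := exists_eval_comp (P j) hφ
    refine ⟨p₁ + (P j - p₂), ?_, fun s hs hsK => ?_⟩
    · refine (totalDegree_add _ _).trans (max_le (hp₁.trans hp)
        ((totalDegree_sub _ _).trans (max_le (hP j) (hp₂.trans (hP j)))))
    have hball : ∀ τ ∈ Metric.ball (0 : ℝ) r,
        Function.update s j τ ∈ Metric.ball (0 : ι → ℝ) r := by
      intro τ hτ
      rw [mem_ball_zero_iff, pi_norm_lt_iff hr] at hs ⊢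
      intro i
      rcases eq_or_ne i j with rfl | hij
      · simpa using hτ
      · simpa [hij] using hs i
    have hline : ∀ τ t : ℝ, Function.update s j τ + (t - τ) • (Pi.single j 1 : ι → ℝ)
        = Function.update s j t := by
      intro τ t
      ext i
      rcases eq_or_ne i j with rfl | hij
      · simp
      · simp [hij]
    have hder : ∀ τ ∈ Metric.ball (0 : ℝ) r, HasDerivAt
        (fun t => F (Function.update s j t) - eval (Function.update s j t) (P j)) 0 τ := by
      intro τ hτ
      have h1 := (hF _ (hball τ hτ) j)
      have h2 := hasLineDerivAt_eval (P j) (Function.update s j τ) j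
      unfold HasLineDerivAt at h1 h2
      have h3 := (h1.fun_sub h2)
      rw [sub_self] at h3
      have h4 := HasDerivAt.comp_sub_const τ τ (by rwa [sub_self])
      simp only [hline] at h4
      exact h4
    have hsj : s j ∈ Metric.ball (0 : ℝ) r := by
      rw [mem_ball_zero_iff] at hs ⊢
      exact (norm_le_pi_norm s j).trans_lt hs
    have hconst := Metric.isOpen_ball.is_const_of_deriv_eq_zero
      (convex_ball (0 : ℝ) r).isPreconnected
      (fun τ hτ => (hder τ hτ).differentiableAt.differentiableWithinAt)
      (fun τ hτ => (hder τ hτ).deriv) hsj (Metric.mem_ball_self hr)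
    simp only [Function.update_eq_self] at hconst
    have hF0 := h (Function.update s j 0) (hball 0 (Metric.mem_ball_self hr)) fun i hi => by
      rcases eq_or_ne i j with rfl | hij
      · simp
      · simpa [hij] using hsK i (by simp [hij, hi])
    simp only [map_add, map_sub, h₁, h₂]
    linarith

/-- Average of `f` over the segment from `x - b` to `x`. -/
noncomputable def segmentAverage {E : Type*} [AddCommGroup E] [Module ℝ E] (b : E) (f : E → ℝ)
    (x : E) : ℝ :=
  ∫ t in (0 : ℝ)..1, f (x - t • b)

/-- Bounded measurable real functions. -/
def BoundedMeasurable {E : Type*} [MeasurableSpace E] (f : E → ℝ) : Prop :=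
  Measurable f ∧ ∃ K, ∀ x, ‖f x‖ ≤ K

section SegmentAverage

variable {E : Type*} [NormedAddCommGroup E] [NormedSpace ℝ E] [MeasurableSpace E] [BorelSpace E]
  {f : E → ℝ}

lemma hasLineDerivAt_segmentAverage (hf : BoundedMeasurable f) {b x : E}
    (h₀ : ContinuousAt f x) (h₁ : ContinuousAt f (x - b)) :
    HasLineDerivAt ℝ (segmentAverage b f) (f x - f (x - b)) x b := by
  obtain ⟨hm, K, hK⟩ := hf
  set g : ℝ → ℝ := fun τ => f (x + τ • b) with hg
  have hgm : Measurable g := hm.comp (by fun_prop)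
  have hgi : ∀ a c : ℝ, IntervalIntegrable g volume a c := fun a c => by
    rw [intervalIntegrable_iff]
    exact Measure.integrableOn_of_bounded (M := K) (by simp) hgm.aestronglyMeasurable
      (Filter.Eventually.of_forall fun z => hK _)
  have hline : ∀ s : ℝ, segmentAverage b f (x + s • b)
      = (∫ τ in (0 : ℝ)..s, g τ) - ∫ τ in (0 : ℝ)..(s - 1), g τ := fun s => by
    rw [intervalIntegral.integral_interval_sub_left (hgi _ _) (hgi _ _)]
    have := intervalIntegral.integral_comp_sub_left g s (a := 0) (b := 1)
    rw [sub_zero] at this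
    rw [← this]
    unfold segmentAverage
    congr 1
    funext t
    simp only [hg]
    congr 1
    module
  have hb : Continuous fun τ : ℝ => x + τ • b := by fun_prop
  have hg0 : ContinuousAt g 0 := by
    refine ContinuousAt.comp (g := f) ?_ hb.continuousAt
    simpa using h₀
  have hg1 : ContinuousAt g (0 - 1) := by
    refine ContinuousAt.comp (g := f) ?_ hb.continuousAt
    simpa [← sub_eq_add_neg] using h₁
  have d0 := intervalIntegral.integral_hasDerivAt_right (hgi 0 0)
    hgm.stronglyMeasurable.stronglyMeasurableAtFilter hg0
  have d1 := (intervalIntegral.integral_hasDerivAt_right (hgi 0 (0 - 1))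
    hgm.stronglyMeasurable.stronglyMeasurableAtFilter hg1).comp_sub_const 0 1
  unfold HasLineDerivAt
  simp only [hline]
  refine (d0.fun_sub d1).congr_deriv ?_
  simp [hg, sub_eq_add_neg]

variable [SecondCountableTopology E]

lemma BoundedMeasurable.segmentAverage (hf : BoundedMeasurable f) (b : E) :
    BoundedMeasurable (segmentAverage b f) := by
  obtain ⟨hm, K, hK⟩ := hf
  refine ⟨?_, K, fun x => ?_⟩
  · have h : StronglyMeasurable fun z : E × ℝ => f (z.1 - z.2 • b) :=
      (hm.comp (by fun_prop)).stronglyMeasurable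
    have h2 := h.integral_prod_right' (ν := volume.restrict (Set.Ioc (0 : ℝ) 1))
    unfold _root_.segmentAverage
    simp only [intervalIntegral.integral_of_le zero_le_one]
    exact h2.measurable
  · have := intervalIntegral.norm_integral_le_of_norm_le_const (a := (0 : ℝ)) (b := 1)
      (f := fun t => f (x - t • b)) (C := K) fun t _ => hK _
    simpa [_root_.segmentAverage] using this

lemma BoundedMeasurable.foldr_segmentAverage (hf : BoundedMeasurable f) (L : List E) :
    BoundedMeasurable (L.foldr _root_.segmentAverage f) := by
  induction L with
  | nil => exact hf
  | cons u L ih => exact ih.segmentAverage u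

lemma segmentAverage_comm (hf : BoundedMeasurable f) (a b : E) :
    segmentAverage a (segmentAverage b f) = segmentAverage b (segmentAverage a f) := by
  obtain ⟨hm, K, hK⟩ := hf
  funext x
  unfold segmentAverage
  rw [MeasureTheory.intervalIntegral_intervalIntegral_swap]
  · simp only [sub_right_comm]
  · refine Measure.integrableOn_of_bounded (M := K) ?_ ?_
      (Filter.Eventually.of_forall fun z => hK _)
    · simp [Measure.volume_eq_prod, Measure.prod_prod, Set.uIoc]
    exact (hm.comp (f := fun z : ℝ × ℝ => x - z.1 • a - z.2 • b) (by fun_prop)).aestronglyMeasurable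

lemma foldr_segmentAverage_comm (hf : BoundedMeasurable f) (b : E) (L : List E) :
    L.foldr segmentAverage (segmentAverage b f) = segmentAverage b (L.foldr segmentAverage f) := by
  induction L with
  | nil => rfl
  | cons u L ih =>
    rw [List.foldr_cons, ih, segmentAverage_comm (hf.foldr_segmentAverage L), List.foldr_cons]

/-- A factor of an iterated average may be moved to the innermost position. -/
lemma foldr_segmentAverage_append_cons (hf : BoundedMeasurable f) (u : E) (L₁ L₂ : List E) :
    (L₁ ++ u :: L₂).foldr segmentAverage f
      = (L₁ ++ L₂).foldr segmentAverage (segmentAverage u f) := by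
  rw [List.foldr_append, List.foldr_append, List.foldr_cons, foldr_segmentAverage_comm hf]

end SegmentAverage

section Base

open Matrix

variable {d : ℕ} {A : Matrix (Fin d) (Fin d) ℝ}

lemma boxSplineBase_of_det_ne_zero (hA : A.det ≠ 0) (x : Fin d → ℝ) :
    boxSplineBase d A x =
      {y | ∀ i, (A⁻¹ *ᵥ y) i ∈ Set.Ico (0 : ℝ) 1}.indicator (fun _ => |A.det|⁻¹) x := by
  have hu : IsUnit A.det := hA.isUnit
  unfold boxSplineBase
  rw [Set.indicator_apply]
  classical
  refine if_congr ⟨?_, fun h => ⟨A⁻¹ *ᵥ x, h, ?_⟩⟩ rfl rfl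
  · rintro ⟨u, hu', rfl⟩
    simpa [mulVec_mulVec, nonsing_inv_mul A hu] using hu'
  · rw [mulVec_mulVec, mul_nonsing_inv A hu, one_mulVec]

lemma boundedMeasurable_boxSplineBase (hA : A.det ≠ 0) : BoundedMeasurable (boxSplineBase d A) := by
  rw [funext (boxSplineBase_of_det_ne_zero hA)]
  refine ⟨measurable_const.indicator ?_, |A.det|⁻¹, fun x => ?_⟩
  · have : Continuous fun y : Fin d → ℝ => A⁻¹ *ᵥ y := by fun_prop
    rw [Set.ofPred_forall]
    exact MeasurableSet.iInter fun i =>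
      ((measurable_pi_apply i).comp this.measurable) measurableSet_Ico
  · refine (norm_indicator_le_norm_self _ _).trans (by simp)

lemma inv_mulVec_col (hA : A.det ≠ 0) (k : Fin d) : A⁻¹ *ᵥ A.col k = Pi.single k 1 := by
  rw [← mulVec_single_one, mulVec_mulVec, nonsing_inv_mul A hA.isUnit, one_mulVec]

lemma det_updateCol_eq (hA : A.det ≠ 0) (u : Fin d → ℝ) (k : Fin d) :
    (A.updateCol k u).det = (A⁻¹ *ᵥ u) k * A.det := by
  rw [← cramer_apply, cramer_eq_adjugate_mulVec, inv_def, Ring.inverse_eq_inv', smul_mulVec]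
  simp [field]

lemma updateCol_mulVec_update (u c : Fin d → ℝ) (k : Fin d) (t : ℝ) :
    A.updateCol k u *ᵥ Function.update c k t = A *ᵥ c - c k • A.col k + t • u := by
  have h (B : Matrix (Fin d) (Fin d) ℝ) (e : Fin d → ℝ) :
      B *ᵥ e = e k • B.col k + ∑ j ∈ Finset.univ.erase k, e j • B.col j := by
    rw [Finset.add_sum_erase _ (fun j => e j • B.col j) (Finset.mem_univ k)]
    ext i
    simp [mulVec, dotProduct, mul_comm]
  have hsum : ∑ j ∈ Finset.univ.erase k, Function.update c k t j • (A.updateCol k u).col j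
      = ∑ j ∈ Finset.univ.erase k, c j • A.col j := by
    refine Finset.sum_congr rfl fun j hj => ?_
    have hjk := Finset.ne_of_mem_erase hj
    ext i
    simp [hjk]
  have hcol : (A.updateCol k u).col k = u := by
    ext i
    simp
  rw [h (A.updateCol k u), h A, hsum, hcol, Function.update_self]
  abel

/-- Averaging the base box spline along a new direction `u` is symmetric under exchanging `u` with
a column of the matrix. -/
lemma segmentAverage_boxSplineBase_exchange (hA : A.det ≠ 0) {u : Fin d → ℝ} {k : Fin d}
    (hk : (A⁻¹ *ᵥ u) k ≠ 0) :
    segmentAverage u (boxSplineBase d A)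
      = segmentAverage (A.col k) (boxSplineBase d (A.updateCol k u)) := by
  classical
  set a := (A⁻¹ *ᵥ u) k with ha
  funext x
  set l := (A⁻¹ *ᵥ x) k with hl
  let P (B : Matrix (Fin d) (Fin d) ℝ) (b : Fin d → ℝ) (t : ℝ) : Prop :=
    t ∈ Set.Ico (0 : ℝ) 1 ∧ ∃ c : Fin d → ℝ, (∀ i, 0 ≤ c i ∧ c i < 1) ∧ B *ᵥ c = x - t • b
  have havg (B : Matrix (Fin d) (Fin d) ℝ) (b : Fin d → ℝ) :
      segmentAverage b (boxSplineBase d B) x = |B.det|⁻¹ * ∫ t, if P B b t then (1 : ℝ) else 0 := by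
    unfold segmentAverage
    rw [intervalIntegral.integral_of_le zero_le_one, ← integral_Ico_eq_integral_Ioc,
      ← integral_indicator measurableSet_Ico, ← integral_const_mul]
    congr 1
    funext t
    simp only [Set.indicator_apply, boxSplineBase, P]
    split_ifs <;> simp_all
  have hP (t : ℝ) : P A u t ↔ P (A.updateCol k u) (A.col k) (l - a * t) := by
    constructor
    · rintro ⟨ht, c, hc, hcx⟩
      have hck : c k = l - a * t := by
        have := congrArg (fun y => (A⁻¹ *ᵥ y) k) hcx
        simp only [mulVec_mulVec, nonsing_inv_mul A hA.isUnit, one_mulVec, mulVec_sub,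
          mulVec_smul] at this
        simpa [mul_comm] using this
      refine ⟨hck ▸ hc k, Function.update c k t, fun i => ?_, ?_⟩
      · rcases eq_or_ne i k with rfl | hik
        · simpa using ht
        · simpa [hik] using hc i
      · rw [updateCol_mulVec_update, hcx, hck]
        abel
    · rintro ⟨hs, c, hc, hcx⟩
      set s := l - a * t with hsdef
      set e := Function.update c k s with he
      have hAe : A *ᵥ e = x - c k • u := by
        have := updateCol_mulVec_update (A := A) u e k (c k)
        rw [he, Function.update_idem, Function.update_eq_self, hcx, Function.update_self] at this
        rw [he]
        linear_combination (exp := 1) -this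
      have hct : c k = t := by
        have := congrArg (fun y => (A⁻¹ *ᵥ y) k) hAe
        simp only [mulVec_mulVec, nonsing_inv_mul A hA.isUnit, one_mulVec, mulVec_sub,
          mulVec_smul, he, Function.update_self, Pi.sub_apply, Pi.smul_apply, smul_eq_mul] at this
        rw [← hl, ← ha, hsdef] at this
        exact mul_left_cancel₀ hk (by linarith)
      refine ⟨hct ▸ hc k, e, fun i => ?_, hct ▸ hAe⟩
      rcases eq_or_ne i k with rfl | hik
      · simpa [he] using hs
      · simpa [he, hik] using hc i
  rw [havg, havg, det_updateCol_eq hA]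
  simp only [hP]
  have h1 := Measure.integral_comp_mul_left
    (fun y => if P (A.updateCol k u) (A.col k) (l - y) then (1 : ℝ) else 0) a
  rw [integral_sub_left_eq_self
    (fun y => if P (A.updateCol k u) (A.col k) y then (1 : ℝ) else 0) volume l] at h1
  rw [h1, ← ha, abs_mul, abs_inv, smul_eq_mul, mul_inv]
  ring

/-- If no averaging direction involves the column `k`, the iterated average depends on the `k`-th
coordinate only through its membership in `[0, 1)`. -/
lemma foldr_segmentAverage_boxSplineBase_add_smul_col (hA : A.det ≠ 0) {k : Fin d} {s : ℝ}
    {L : List (Fin d → ℝ)} (hL : ∀ u ∈ L, (A⁻¹ *ᵥ u) k = 0) {x : Fin d → ℝ}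
    (hx : (A⁻¹ *ᵥ x) k + s ∈ Set.Ico (0 : ℝ) 1 ↔ (A⁻¹ *ᵥ x) k ∈ Set.Ico (0 : ℝ) 1) :
    L.foldr segmentAverage (boxSplineBase d A) (x + s • A.col k)
      = L.foldr segmentAverage (boxSplineBase d A) x := by
  induction L generalizing x with
  | nil =>
    simp only [List.foldr_nil, boxSplineBase_of_det_ne_zero hA, Set.indicator_apply]
    refine if_congr (forall_congr' fun i => ?_) rfl rfl
    rw [mulVec_add, mulVec_smul, inv_mulVec_col hA]
    rcases eq_or_ne i k with rfl | hik
    · simpa using hx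
    · simp [hik]
  | cons u L ih =>
    simp only [List.foldr_cons, segmentAverage]
    congr 1
    funext t
    rw [add_sub_right_comm]
    refine ih (fun w hw => hL w (List.mem_cons_of_mem _ hw)) ?_
    have : (A⁻¹ *ᵥ (x - t • u)) k = (A⁻¹ *ᵥ x) k := by
      simp [mulVec_sub, mulVec_smul, hL u List.mem_cons_self]
    rwa [this]

end Base

lemma boxSpline_eq_foldr {d n : ℕ} (hdn : d ≤ n) (w : Fin n → Fin d → ℝ) :
    ∃ L : List (Fin d → ℝ), L.length = n - d ∧ (∀ u ∈ L, u ∈ Set.range w) ∧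
      boxSpline d n w = L.foldr segmentAverage (boxSplineBase d (leadMat d n hdn w)) := by
  induction n, hdn using Nat.le_induction with
  | base =>
    refine ⟨[], by simp, by simp, ?_⟩
    funext x
    rw [boxSpline, dif_pos rfl]
    rfl
  | succ n hdn ih =>
    obtain ⟨L, hlen, hL, hfold⟩ := ih fun k => w k.castSucc
    refine ⟨w (Fin.last n) :: L, by simp [hlen]; omega, ?_, ?_⟩
    · intro u hu
      rcases List.mem_cons.1 hu with rfl | hu
      · exact ⟨_, rfl⟩
      · obtain ⟨k, rfl⟩ := hL u hu
        exact ⟨_, rfl⟩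
    · funext x
      rw [boxSpline, dif_neg (by omega), dif_neg (by omega)]
      exact congrArg (fun g => segmentAverage (w (Fin.last n)) g x) hfold

section Local

open MvPolynomial Matrix Filter
open scoped Topology

lemma exists_eval_add_mulVec {d : ℕ} (y : Fin d → ℝ) (B : Matrix (Fin d) (Fin d) ℝ) (i : Fin d) :
    ∃ q : MvPolynomial (Fin d) ℝ, q.totalDegree ≤ 1 ∧ ∀ x, (y + B *ᵥ x) i = eval x q := by
  refine ⟨C (y i) + ∑ j, C (B i j) * X j, ?_, fun x => by simp [mulVec, dotProduct]⟩
  refine (totalDegree_add _ _).trans (max_le (by simp) (totalDegree_finsetSum_le fun j _ => ?_))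
  exact (totalDegree_mul _ _).trans (by simp)

/-- A function whose derivatives along the columns of an invertible matrix are, near a point,
polynomials of degree less than `m` (or zero) is, near that point, a polynomial of degree at most
`m`. -/
lemma exists_eventuallyEq_eval_of_hasLineDerivAt {d m : ℕ} {A : Matrix (Fin d) (Fin d) ℝ}
    (hA : A.det ≠ 0) {f : (Fin d → ℝ) → ℝ} {x₀ : Fin d → ℝ}
    (h : ∀ k, ∃ q : MvPolynomial (Fin d) ℝ, (q.totalDegree + 1 ≤ m ∨ q = 0) ∧
      ∀ᶠ x in 𝓝 x₀, HasLineDerivAt ℝ f (eval x q) x (A.col k)) :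
    ∃ p : MvPolynomial (Fin d) ℝ, p.totalDegree ≤ m ∧ f =ᶠ[𝓝 x₀] fun x => eval x p := by
  have key : ∀ k, ∃ P : MvPolynomial (Fin d) ℝ, P.totalDegree ≤ m ∧ ∀ᶠ x in 𝓝 x₀,
      ∀ s, x = x₀ + A *ᵥ s → HasLineDerivAt ℝ f (eval s (pderiv k P)) x (A.col k) := by
    intro k
    obtain ⟨q, hq | rfl, hder⟩ := h k
    · obtain ⟨q', hq', he⟩ := exists_eval_comp q (exists_eval_add_mulVec x₀ A)
      obtain ⟨P, hP, hPq⟩ := exists_pderiv_eq k q'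
      refine ⟨P, by omega, hder.mono fun x hx s hs => ?_⟩
      rwa [hPq, he, ← hs]
    · exact ⟨0, by simp, hder.mono fun x hx s _ => by simpa using hx⟩
  choose P hP hder using key
  have hcont : Continuous fun s : Fin d → ℝ => x₀ + A *ᵥ s := by fun_prop
  have hev : ∀ᶠ s in 𝓝 (0 : Fin d → ℝ), ∀ k,
      HasLineDerivAt ℝ f (eval s (pderiv k (P k))) (x₀ + A *ᵥ s) (A.col k) := by
    have ht : Tendsto (fun s : Fin d → ℝ => x₀ + A *ᵥ s) (𝓝 0) (𝓝 x₀) := by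
      simpa using hcont.tendsto 0
    exact (ht.eventually (eventually_all.2 hder)).mono fun s hs k => hs k s rfl
  obtain ⟨r, hr, hball⟩ := Metric.eventually_nhds_iff_ball.1 hev
  obtain ⟨p, hp, hFp⟩ := exists_eval_eq_of_hasLineDerivAt (F := fun s => f (x₀ + A *ᵥ s)) hr hP
    fun s hs k => by
      have := hball s hs k
      unfold HasLineDerivAt at this ⊢
      simpa only [mulVec_add, mulVec_smul, mulVec_single_one, add_assoc] using this
  obtain ⟨p', hp', he⟩ := exists_eval_comp p (exists_eval_add_mulVec (-(A⁻¹ *ᵥ x₀)) A⁻¹)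
  refine ⟨p', hp'.trans hp, ?_⟩
  have ht : Tendsto (fun x : Fin d → ℝ => -(A⁻¹ *ᵥ x₀) + A⁻¹ *ᵥ x) (𝓝 x₀) (𝓝 0) := by
    have : Continuous fun x : Fin d → ℝ => -(A⁻¹ *ᵥ x₀) + A⁻¹ *ᵥ x := by fun_prop
    simpa using this.tendsto x₀
  filter_upwards [ht.eventually (Metric.ball_mem_nhds 0 hr)] with x hx
  rw [he, ← hFp _ hx]
  simp [mulVec_add, mulVec_neg, mulVec_mulVec, mul_nonsing_inv A hA.isUnit]

/-- A function that is locally a polynomial of degree at most `m` along a preconnected set agrees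
there with a single such polynomial. -/
lemma IsPreconnected.exists_eval_eq {σ : Type*} [Finite σ] {m : ℕ} {f : (σ → ℝ) → ℝ}
    {U : Set (σ → ℝ)} (hU : IsPreconnected U)
    (h : ∀ x ∈ U, ∃ p : MvPolynomial σ ℝ, p.totalDegree ≤ m ∧ f =ᶠ[𝓝 x] fun y => eval y p) :
    ∃ p : MvPolynomial σ ℝ, p.totalDegree ≤ m ∧ ∀ y ∈ U, f y = eval y p := by
  rcases U.eq_empty_or_nonempty with rfl | ⟨x, hx⟩
  · exact ⟨0, by simp, by simp⟩
  obtain ⟨p, hp, hfp⟩ := h x hx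
  have hopen (q : MvPolynomial σ ℝ) : IsOpen {y | f =ᶠ[𝓝 y] fun z => eval z q} :=
    isOpen_setOfPred_eventually_nhds
  have hsub := hU.subset_left_of_subset_union (hopen p)
    (isOpen_biUnion fun (q : MvPolynomial σ ℝ) (_ : q ≠ p) => hopen q) ?_ ?_ ⟨x, hx, hfp⟩
  · exact ⟨p, hp, fun y hy => (hsub hy).eq_of_nhds⟩
  · rw [Set.disjoint_left]
    intro y hy hy'
    obtain ⟨q, hqp, hq⟩ := Set.mem_iUnion₂.1 hy'
    exact hqp (eq_of_eventuallyEq_eval (hq.symm.trans hy))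
  · intro y hy
    obtain ⟨q, _, hq⟩ := h y hy
    by_cases hqp : q = p
    · exact Or.inl (hqp ▸ hq)
    · exact Or.inr (Set.mem_iUnion₂.2 ⟨q, hqp, hq⟩)

variable {d n : ℕ} {v : Fin n → Fin d → ℤ} {A : Matrix (Fin d) (Fin d) ℝ} {x u : Fin d → ℝ}

lemma sub_notMem_meshSet (hx : x ∉ meshSet d n (intCols d n v))
    (hu : u ∈ Set.range (intCols d n v)) : x - u ∉ meshSet d n (intCols d n v) := by
  obtain ⟨k, rfl⟩ := hu
  rintro ⟨y, hy, i, hi⟩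
  refine hx ⟨y, hy, i + v k, ?_⟩
  rw [sub_eq_iff_eq_add.1 hi]
  ext j
  simp [intCols, add_assoc]

lemma inv_mulVec_ne_zero_of_notMem_meshSet (hA : A.det ≠ 0)
    (hcol : ∀ j, A.col j ∈ Set.range (intCols d n v))
    (hx : x ∉ meshSet d n (intCols d n v)) (k : Fin d) : (A⁻¹ *ᵥ x) k ≠ 0 := by
  classical
  intro h0
  choose σ hσ using hcol
  have himage : intCols d n v '' ↑((Finset.univ.erase k).image σ)
      = Set.range fun j : {j // j ≠ k} => A.col j := by
    ext y
    simp [← hσ]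
  refine hx ⟨x, ⟨(Finset.univ.erase k).image σ, ?_, ?_⟩, 0, by ext; simp⟩
  · rw [himage]
    have hli : LinearIndependent ℝ fun j : {j // j ≠ k} => A.col j :=
      (linearIndependent_cols_of_det_ne_zero hA).comp _ Subtype.val_injective
    rw [finrank_span_eq_card hli]
    simp
  · rw [himage]
    have hsum : x = ∑ j, (A⁻¹ *ᵥ x) j • A.col j := by
      conv_lhs => rw [← one_mulVec x, ← mul_nonsing_inv A hA.isUnit, ← mulVec_mulVec]
      ext i
      simp [mulVec, dotProduct, mul_comm]
    rw [hsum]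
    refine Submodule.sum_mem _ fun j _ => ?_
    rcases eq_or_ne j k with rfl | hjk
    · simp [h0]
    · exact Submodule.smul_mem _ _ (Submodule.subset_span ⟨⟨j, hjk⟩, rfl⟩)

lemma inv_mulVec_ne_one_of_notMem_meshSet (hA : A.det ≠ 0)
    (hcol : ∀ j, A.col j ∈ Set.range (intCols d n v))
    (hx : x ∉ meshSet d n (intCols d n v)) (k : Fin d) : (A⁻¹ *ᵥ x) k ≠ 1 := by
  intro h1
  refine inv_mulVec_ne_zero_of_notMem_meshSet hA hcol (sub_notMem_meshSet hx (hcol k)) k ?_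
  rw [mulVec_sub, inv_mulVec_col hA]
  simp [h1]

lemma hasLineDerivAt_foldr_segmentAverage_zero (hA : A.det ≠ 0)
    (hcol : ∀ j, A.col j ∈ Set.range (intCols d n v)) {k : Fin d} {L : List (Fin d → ℝ)}
    (hL : ∀ u ∈ L, (A⁻¹ *ᵥ u) k = 0) (hx : x ∉ meshSet d n (intCols d n v)) :
    ∀ᶠ y in 𝓝 x,
      HasLineDerivAt ℝ (L.foldr segmentAverage (boxSplineBase d A)) 0 y (A.col k) := by
  have hc : Continuous fun y : Fin d → ℝ => (A⁻¹ *ᵥ y) k := by fun_prop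
  filter_upwards [hc.continuousAt.eventually_ne (inv_mulVec_ne_zero_of_notMem_meshSet hA hcol hx k),
    hc.continuousAt.eventually_ne (inv_mulVec_ne_one_of_notMem_meshSet hA hcol hx k)] with y h0 h1
  have hs : Continuous fun s : ℝ => (A⁻¹ *ᵥ y) k + s := by fun_prop
  have hico : ∀ᶠ s in 𝓝 (0 : ℝ), ((A⁻¹ *ᵥ y) k + s ∈ Set.Ico (0 : ℝ) 1 ↔
      (A⁻¹ *ᵥ y) k ∈ Set.Ico (0 : ℝ) 1) := by
    have ht : Tendsto (fun s : ℝ => (A⁻¹ *ᵥ y) k + s) (𝓝 0) (𝓝 ((A⁻¹ *ᵥ y) k)) := by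
      simpa using hs.tendsto 0
    rcases lt_or_gt_of_ne h0 with h | h
    · filter_upwards [ht.eventually_lt_const h] with s hs
      simp [hs.not_ge, h.not_ge]
    rcases lt_or_gt_of_ne h1 with h' | h'
    · filter_upwards [ht.eventually_lt_const h', ht.eventually_const_lt h] with s hs hs'
      simp [hs, hs'.le, h', h.le]
    · filter_upwards [ht.eventually_const_lt h'] with s hs
      simp [hs.not_gt, h'.not_gt]
  refine (hasDerivAt_const (0 : ℝ)
    (L.foldr segmentAverage (boxSplineBase d A) y)).congr_of_eventuallyEq ?_
  exact hico.mono fun s hs => foldr_segmentAverage_boxSplineBase_add_smul_col hA hL hs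

lemma exists_eventuallyEq_eval_foldr_segmentAverage (m : ℕ) (hA : A.det ≠ 0)
    (hcol : ∀ j, A.col j ∈ Set.range (intCols d n v)) {L : List (Fin d → ℝ)}
    (hlen : L.length = m) (hL : ∀ u ∈ L, u ∈ Set.range (intCols d n v))
    (hx : x ∉ meshSet d n (intCols d n v)) :
    ∃ p : MvPolynomial (Fin d) ℝ, p.totalDegree ≤ m ∧
      L.foldr segmentAverage (boxSplineBase d A) =ᶠ[𝓝 x] fun y => eval y p := by
  induction m using Nat.strong_induction_on generalizing A L x with
  | _ m ih =>
  refine exists_eventuallyEq_eval_of_hasLineDerivAt hA fun k => ?_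
  by_cases hk : ∀ u ∈ L, (A⁻¹ *ᵥ u) k = 0
  · exact ⟨0, Or.inr rfl, by simpa using hasLineDerivAt_foldr_segmentAverage_zero hA hcol hk hx⟩
  push Not at hk
  obtain ⟨u, huL, hu⟩ := hk
  obtain ⟨L₁, L₂, rfl⟩ := List.append_of_mem huL
  have hA' : (A.updateCol k u).det ≠ 0 := by
    rw [det_updateCol_eq hA]
    exact mul_ne_zero hu hA
  have hcol' : ∀ j, (A.updateCol k u).col j ∈ Set.range (intCols d n v) := by
    intro j
    rcases eq_or_ne j k with rfl | hjk
    · convert hL u huL using 1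
      ext i
      simp
    · convert hcol j using 1
      ext i
      simp [hjk]
  have hL' : ∀ w ∈ L₁ ++ L₂, w ∈ Set.range (intCols d n v) := fun w hw => hL w (by
    simp only [List.mem_append, List.mem_cons] at hw ⊢
    tauto)
  have hlen' : (L₁ ++ L₂).length + 1 = m := by
    rw [← hlen]
    simp
    omega
  have hbase := boundedMeasurable_boxSplineBase hA'
  have hfold : (L₁ ++ u :: L₂).foldr segmentAverage (boxSplineBase d A)
      = segmentAverage (A.col k)
        ((L₁ ++ L₂).foldr segmentAverage (boxSplineBase d (A.updateCol k u))) := by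
    rw [foldr_segmentAverage_append_cons (boundedMeasurable_boxSplineBase hA),
      segmentAverage_boxSplineBase_exchange hA hu, foldr_segmentAverage_comm hbase]
  obtain ⟨p₀, hp₀, h₀⟩ := ih _ (by omega) hA' hcol' rfl hL' hx
  obtain ⟨p₁, hp₁, h₁⟩ := ih _ (by omega) hA' hcol' rfl hL' (sub_notMem_meshSet hx (hcol k))
  obtain ⟨q, hq, he⟩ := exists_eval_comp p₁ (exists_eval_add_mulVec (-A.col k) 1)
  refine ⟨p₀ - q, Or.inl ?_, ?_⟩
  · have := (totalDegree_sub p₀ q).trans (max_le hp₀ (hq.trans hp₁))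
    omega
  have hsub : Tendsto (fun y => y - A.col k) (𝓝 x) (𝓝 (x - A.col k)) :=
    (continuous_sub_right _).tendsto x
  filter_upwards [h₀.eventuallyEq_nhds, hsub.eventually h₁.eventuallyEq_nhds] with y hy₀ hy₁
  have hder := hasLineDerivAt_segmentAverage (hbase.foldr_segmentAverage (L₁ ++ L₂))
    (b := A.col k) (x := y) ((continuous_eval p₀).continuousAt.congr hy₀.symm)
    ((continuous_eval p₁).continuousAt.congr hy₁.symm)
  rw [hfold, map_sub, he, one_mulVec, neg_add_eq_sub]
  rwa [hy₀.eq_of_nhds, hy₁.eq_of_nhds] at hder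

end Local

/-- `M_Ξ` is a piecewise polynomial of total degree `n - d` over the
mesh `Δ(Ξ)`: on each connected component of `ℝ^d ∖ Δ(Ξ)` it coincides with a polynomial
in `d` variables of total degree at most `n - d`. -/
theorem boxSpline_piecewise_polynomial (d n : ℕ) (hdn : d ≤ n)
    (v : Fin n → Fin d → ℤ) (hv : ∀ k, v k ≠ 0)
    (hns : (leadMat d n hdn (intCols d n v)).det ≠ 0) :
    ∀ x ∉ meshSet d n (intCols d n v),
      ∃ p : MvPolynomial (Fin d) ℝ, p.totalDegree ≤ n - d ∧
        ∀ y ∈ connectedComponentIn (meshSet d n (intCols d n v))ᶜ x,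
          boxSpline d n (intCols d n v) y = MvPolynomial.eval y p := by
  intro x _
  obtain ⟨L, hlen, hL, hfold⟩ := boxSpline_eq_foldr hdn (intCols d n v)
  rw [hfold]
  exact isPreconnected_connectedComponentIn.exists_eval_eq fun y hy =>
    exists_eventuallyEq_eval_foldr_segmentAverage (n - d) hns (fun j => ⟨Fin.castLE hdn j, rfl⟩)
      hlen hL (connectedComponentIn_subset _ _ hy)
end
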